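/- Let γ : ℝ × (-∞,0] → ℝ² be an ancient complete non-compact embedded smooth curve shortening flow. Then the flow has finite total curvature (sup over t ≤ 0 of TC(t) is finite) if and only if it has finite entropy (Ent < ∞). -/

import Mathlib

open Real MeasureTheory Set Filter
open scoped RealInnerProductSpace ENNReal

noncomputable section

/-- The Euclidean plane. -/
abbrev R2 := EuclideanSpace ℝ (Fin 2)

/-- The point of `ℝ²` with coordinates `(x, y)`. -/
def toR2 (x y : ℝ) : R2 := (WithLp.equiv 2 (Fin 2 → ℝ)).symm ![x, y]

/-- Counterclockwise rotation of the plane by `π/2`. -/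
def Jrot (v : R2) : R2 := toR2 (-(v 1)) (v 0)

/-- Arclength derivative `∂ₛ := |∂ᵤγ|⁻¹ ∂ᵤ` along the time-`t` curve of the flow `γ`,
applied to a function `f` of `(u, t)`. -/
def aderiv (γ : ℝ → ℝ → R2) {F : Type} [NormedAddCommGroup F] [NormedSpace ℝ F]
    (f : ℝ → ℝ → F) (u t : ℝ) : F :=
  ‖deriv (fun v => γ v t) u‖⁻¹ • deriv (fun v => f v t) u

/-- The unit tangent `T = ∂ᵤγ / |∂ᵤγ|`. -/
def unitT (γ : ℝ → ℝ → R2) (u t : ℝ) : R2 := aderiv γ γ u t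

/-- The unit normal `n = J T`. -/
def unitN (γ : ℝ → ℝ → R2) (u t : ℝ) : R2 := Jrot (unitT γ u t)

/-- The signed curvature `κ = ⟨∂ₛT, n⟩`. -/
def curv (γ : ℝ → ℝ → R2) (u t : ℝ) : ℝ := ⟪aderiv γ (unitT γ) u t, unitN γ u t⟫

/-- `γ : ℝ × I → ℝ²` is a smooth curve shortening flow in fixed-parametrization form:
smooth, regular (`∂ᵤγ ≠ 0`), and `∂ₜγ = ∂ₛ(∂ₛγ)` (time derivative taken within `I`). -/
structure IsCSF (γ : ℝ → ℝ → R2) (I : Set ℝ) : Prop where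
  smooth : ContDiffOn ℝ (⊤ : ℕ∞) (fun p : ℝ × ℝ => γ p.1 p.2) (univ ×ˢ I)
  regular : ∀ (u : ℝ), ∀ t ∈ I, deriv (fun v => γ v t) u ≠ 0
  flow : ∀ (u : ℝ), ∀ t ∈ I, derivWithin (fun s => γ u s) I t = aderiv γ (aderiv γ γ) u t

/-- The Gaussian weighted length `F_{x₀,l}` of the time-`t` curve (as an extended real). -/
def gaussLenE (γ : ℝ → ℝ → R2) (x₀ : R2) (l t : ℝ) : ℝ≥0∞ :=
  (ENNReal.ofReal (Real.sqrt (4 * π * l)))⁻¹ *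
    ∫⁻ u : ℝ, ENNReal.ofReal
      (Real.exp (-‖γ u t - x₀‖ ^ 2 / (4 * l)) * ‖deriv (fun v => γ v t) u‖)

/-- The total curvature of the time-`t` curve (as an extended real). -/
def totalCurvE (γ : ℝ → ℝ → R2) (t : ℝ) : ℝ≥0∞ :=
  ∫⁻ u : ℝ, ENNReal.ofReal (|curv γ u t| * ‖deriv (fun v => γ v t) u‖)

/-- The entropy of the flow: the supremum of the Gaussian weighted lengths over all
times `t ∈ I`, centers `x₀ ∈ ℝ²` and scales `l > 0`. -/
def entropyE (γ : ℝ → ℝ → R2) (I : Set ℝ) : ℝ≥0∞ :=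
  ⨆ t ∈ I, ⨆ x₀ : R2, ⨆ l ∈ Ioi (0:ℝ), gaussLenE γ x₀ l t


open Topology

/-- Smoothness (in both variables) on `t < 0`. -/
def Sm {E : Type} [NormedAddCommGroup E] [NormedSpace ℝ E] (F : ℝ → ℝ → E) : Prop :=
  ∀ p : ℝ × ℝ, p.2 < 0 → ContDiffAt ℝ (⊤ : ℕ∞) (fun p : ℝ × ℝ => F p.1 p.2) p

section smtools
variable {E : Type} [NormedAddCommGroup E] [NormedSpace ℝ E]

theorem Sm.diffAt {F : ℝ → ℝ → E} (h : Sm F) (u : ℝ) {t : ℝ} (ht : t < 0) :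
    DifferentiableAt ℝ (fun p : ℝ × ℝ => F p.1 p.2) (u, t) :=
  (h (u, t) ht).differentiableAt (by simp)

theorem Sm.hu' {F : ℝ → ℝ → E} (h : Sm F) (u : ℝ) {t : ℝ} (ht : t < 0) :
    HasDerivAt (fun v => F v t) (fderiv ℝ (fun p : ℝ × ℝ => F p.1 p.2) (u, t) (1, 0)) u := by
  have h1 : HasDerivAt (fun v : ℝ => ((v, t) : ℝ × ℝ)) (1, 0) u :=
    (hasDerivAt_id u).prodMk (hasDerivAt_const u t)
  exact ((h.diffAt u ht).hasFDerivAt).comp_hasDerivAt u h1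

theorem Sm.ht' {F : ℝ → ℝ → E} (h : Sm F) (u : ℝ) {t : ℝ} (ht : t < 0) :
    HasDerivAt (fun s => F u s) (fderiv ℝ (fun p : ℝ × ℝ => F p.1 p.2) (u, t) (0, 1)) t := by
  have h1 : HasDerivAt (fun s : ℝ => ((u, s) : ℝ × ℝ)) (0, 1) t :=
    (hasDerivAt_const t u).prodMk (hasDerivAt_id t)
  exact ((h.diffAt u ht).hasFDerivAt).comp_hasDerivAt t h1

/-- `u`-derivative. -/
def du (F : ℝ → ℝ → E) (u t : ℝ) : E := deriv (fun v => F v t) u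
/-- `t`-derivative. -/
def dt (F : ℝ → ℝ → E) (u t : ℝ) : E := deriv (fun s => F u s) t

theorem Sm.hu {F : ℝ → ℝ → E} (h : Sm F) (u : ℝ) {t : ℝ} (ht : t < 0) :
    HasDerivAt (fun v => F v t) (du F u t) u :=
  (h.hu' u ht).differentiableAt.hasDerivAt

theorem Sm.ht {F : ℝ → ℝ → E} (h : Sm F) (u : ℝ) {t : ℝ} (ht : t < 0) :
    HasDerivAt (fun s => F u s) (dt F u t) t :=
  (h.ht' u ht).differentiableAt.hasDerivAt

theorem ev_neg (p : ℝ × ℝ) (hp : p.2 < 0) : ∀ᶠ q : ℝ × ℝ in 𝓝 p, q.2 < 0 :=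
  (isOpen_lt continuous_snd continuous_const).mem_nhds hp

theorem Sm.congr {F G : ℝ → ℝ → E} (h : Sm F) (hG : ∀ u t, t < 0 → G u t = F u t) : Sm G := by
  intro p hp
  refine (h p hp).congr_of_eventuallyEq ?_
  filter_upwards [ev_neg p hp] with q hq using hG _ _ hq

theorem Sm.fd {F : ℝ → ℝ → E} (h : Sm F) (w : ℝ × ℝ) :
    Sm (fun u t => fderiv ℝ (fun p : ℝ × ℝ => F p.1 p.2) (u, t) w) := by
  intro p hp
  have h1 : ContDiffAt ℝ (⊤ : ℕ∞) (fderiv ℝ (fun p : ℝ × ℝ => F p.1 p.2)) p :=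
    (h p hp).fderiv_right (by simp)
  exact h1.clm_apply contDiffAt_const

theorem Sm.du {F : ℝ → ℝ → E} (h : Sm F) : Sm (du F) :=
  (h.fd (1, 0)).congr fun u _ ht => (h.hu' u ht).deriv

theorem Sm.dt {F : ℝ → ℝ → E} (h : Sm F) : Sm (dt F) :=
  (h.fd (0, 1)).congr fun u _ ht => (h.ht' u ht).deriv

theorem Sm.comm {F : ℝ → ℝ → E} (h : Sm F) (u : ℝ) {t : ℝ} (ht : t < 0) :
    _root_.du (_root_.dt F) u t = _root_.dt (_root_.du F) u t := by
  have e1 : _root_.du (_root_.dt F) u t =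
      _root_.du (fun u t => fderiv ℝ (fun p : ℝ × ℝ => F p.1 p.2) (u, t) (0, 1)) u t := by
    unfold _root_.du
    congr 1
    funext v
    exact (h.ht' v ht).deriv
  have e2 : _root_.dt (_root_.du F) u t =
      _root_.dt (fun u t => fderiv ℝ (fun p : ℝ × ℝ => F p.1 p.2) (u, t) (1, 0)) u t := by
    unfold _root_.dt
    refine Filter.EventuallyEq.deriv_eq ?_
    filter_upwards [isOpen_Iio.mem_nhds (show t ∈ Iio (0:ℝ) from ht)] with s hs
    exact (h.hu' u hs).deriv
  have hs : IsSymmSndFDerivAt ℝ (fun p : ℝ × ℝ => F p.1 p.2) (u, t) :=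
    (h (u, t) ht).isSymmSndFDerivAt (by
      simp only [minSmoothness_of_isRCLikeNormedField]; exact WithTop.coe_le_coe.2 (le_top : (2 : ℕ∞) ≤ ⊤))
  have hd : DifferentiableAt ℝ (fderiv ℝ (fun p : ℝ × ℝ => F p.1 p.2)) (u, t) :=
    (((h (u, t) ht).fderiv_right (m := (⊤ : ℕ∞)) (by simp))).differentiableAt (by simp)
  have key : ∀ a b : ℝ × ℝ, fderiv ℝ (fun p : ℝ × ℝ =>
      fderiv ℝ (fun p : ℝ × ℝ => F p.1 p.2) (p.1, p.2) a) (u, t) b =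
      fderiv ℝ (fderiv ℝ (fun p : ℝ × ℝ => F p.1 p.2)) (u, t) b a := by
    intro a b
    have := (hd.hasFDerivAt.clm_apply (hasFDerivAt_const a (u, t))).fderiv
    simp only [Prod.mk.eta]
    rw [this]
    simp
  rw [e1, e2]
  have k1 := ((h.fd (0, 1)).hu' u ht).deriv
  have k2 := ((h.fd (1, 0)).ht' u ht).deriv
  unfold _root_.du _root_.dt
  rw [k1, k2, key, key]
  exact hs.eq _ _

theorem Sm.cont_u {F : ℝ → ℝ → E} (h : Sm F) {t : ℝ} (ht : t < 0) :
    Continuous (fun u => F u t) :=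
  continuous_iff_continuousAt.2 fun u => (h.hu u ht).continuousAt

theorem Sm.contOn {F : ℝ → ℝ → E} (h : Sm F) :
    ContinuousOn (fun p : ℝ × ℝ => F p.1 p.2) {p | p.2 < 0} :=
  fun p hp => (h p hp).continuousAt.continuousWithinAt

/-- Differentiation under the integral sign. -/
theorem Sm.hasDerivAt_integral {H : ℝ → ℝ → ℝ} (h : Sm H) (α β : ℝ) {t : ℝ} (ht : t < 0) :
    HasDerivAt (fun s => ∫ u in α..β, H u s) (∫ u in α..β, _root_.dt H u t) t := by
  set r := -t / 2 with hr
  have hr0 : 0 < r := by rw [hr]; linarith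
  have hneg : ∀ s ∈ Metric.closedBall t r, s < 0 := by
    intro s hs
    rw [Metric.mem_closedBall, Real.dist_eq, abs_le] at hs
    linarith [hs.2]
  have hK : IsCompact (uIcc α β ×ˢ Metric.closedBall t r) :=
    isCompact_uIcc.prod (isCompact_closedBall t r)
  obtain ⟨C, hC⟩ := hK.exists_bound_of_continuousOn
    (f := fun p : ℝ × ℝ => _root_.dt H p.1 p.2) (h.dt.contOn.mono (by
      rintro ⟨a, b⟩ ⟨_, hb⟩
      exact hneg b hb))
  refine (intervalIntegral.hasDerivAt_integral_of_dominated_loc_of_deriv_le (F := fun s u => H u s)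
    (F' := fun s u => _root_.dt H u s)
    (bound := fun _ => C) (Metric.ball_mem_nhds t hr0) ?_ ?_ ?_ ?_ ?_ ?_).2
  · filter_upwards [isOpen_Iio.mem_nhds (show t ∈ Iio (0:ℝ) from ht)] with s hs
    exact (h.cont_u hs).aestronglyMeasurable
  · exact (h.cont_u ht).intervalIntegrable _ _
  · exact (h.dt.cont_u ht).aestronglyMeasurable
  · refine Eventually.of_forall fun u hu s hs => ?_
    exact hC (u, s) ⟨uIoc_subset_uIcc hu, Metric.ball_subset_closedBall hs⟩
  · exact intervalIntegrable_const
  · refine Eventually.of_forall fun u hu s hs => ?_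
    exact h.ht u (hneg s (Metric.ball_subset_closedBall hs))

end smtools

section smalg
variable {F G : ℝ → ℝ → ℝ}

theorem dt_congr (h : ∀ u t, t < 0 → F u t = G u t) (u : ℝ) {t : ℝ} (ht : t < 0) :
    dt F u t = dt G u t := by
  unfold dt
  refine Filter.EventuallyEq.deriv_eq ?_
  filter_upwards [isOpen_Iio.mem_nhds (show t ∈ Iio (0:ℝ) from ht)] with s hs
  exact h u s hs

theorem du_congr (h : ∀ u t, t < 0 → F u t = G u t) (u : ℝ) {t : ℝ} (ht : t < 0) :
    du F u t = du G u t := by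
  unfold du
  congr 1
  funext v
  exact h v t ht

theorem Sm.mul (hF : Sm F) (hG : Sm G) : Sm (fun u t => F u t * G u t) :=
  fun p hp => (hF p hp).mul (hG p hp)
theorem Sm.add (hF : Sm F) (hG : Sm G) : Sm (fun u t => F u t + G u t) :=
  fun p hp => (hF p hp).add (hG p hp)
theorem Sm.sub (hF : Sm F) (hG : Sm G) : Sm (fun u t => F u t - G u t) :=
  fun p hp => (hF p hp).sub (hG p hp)
theorem Sm.neg (hF : Sm F) : Sm (fun u t => - F u t) :=
  fun p hp => (hF p hp).neg
theorem Sm.const (r : ℝ) : Sm (fun _ _ => r) :=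
  fun _ _ => contDiffAt_const
theorem Sm.div (hF : Sm F) (hG : Sm G) (h0 : ∀ u t, t < 0 → G u t ≠ 0) :
    Sm (fun u t => F u t / G u t) :=
  fun p hp => (hF p hp).div (hG p hp) (h0 _ _ hp)
theorem Sm.sqrt (hF : Sm F) (h0 : ∀ u t, t < 0 → F u t ≠ 0) :
    Sm (fun u t => Real.sqrt (F u t)) :=
  fun p hp => (hF p hp).sqrt (h0 _ _ hp)
theorem Sm.comp (hF : Sm F) {h : ℝ → ℝ} (hh : ContDiff ℝ (⊤ : ℕ∞) h) :
    Sm (fun u t => h (F u t)) :=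
  fun p hp => hh.contDiffAt.comp p (hF p hp)
theorem Sm.tvar : Sm (fun _ t => t) := fun _ _ => contDiffAt_snd

theorem Sm.dt_mul (hF : Sm F) (hG : Sm G) (u : ℝ) {t : ℝ} (ht : t < 0) :
    _root_.dt (fun u t => F u t * G u t) u t
      = _root_.dt F u t * G u t + F u t * _root_.dt G u t :=
  ((hF.ht u ht).mul (hG.ht u ht)).deriv
theorem Sm.du_mul (hF : Sm F) (hG : Sm G) (u : ℝ) {t : ℝ} (ht : t < 0) :
    _root_.du (fun u t => F u t * G u t) u t
      = _root_.du F u t * G u t + F u t * _root_.du G u t :=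
  ((hF.hu u ht).mul (hG.hu u ht)).deriv
theorem Sm.dt_neg (hF : Sm F) (u : ℝ) {t : ℝ} (ht : t < 0) :
    _root_.dt (fun u t => - F u t) u t = - _root_.dt F u t := ((hF.ht u ht).neg).deriv
theorem Sm.du_neg (hF : Sm F) (u : ℝ) {t : ℝ} (ht : t < 0) :
    _root_.du (fun u t => - F u t) u t = - _root_.du F u t := ((hF.hu u ht).neg).deriv

end smalg

/-- The scalar form of the curve shortening flow on `t < 0`: `(x, y)` is the position, `v` the
speed, `(c, s)` the unit tangent, `k` the curvature. -/
structure Fl (x y v k c s : ℝ → ℝ → ℝ) : Prop where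
  sx : Sm x
  sy : Sm y
  sv : Sm v
  sk : Sm k
  sc : Sm c
  ss : Sm s
  vpos : ∀ u t, t < 0 → 0 < v u t
  unit : ∀ u t, t < 0 → c u t ^ 2 + s u t ^ 2 = 1
  xu : ∀ u t, t < 0 → du x u t = v u t * c u t
  yu : ∀ u t, t < 0 → du y u t = v u t * s u t
  xt : ∀ u t, t < 0 → dt x u t = -(k u t * s u t)
  yt : ∀ u t, t < 0 → dt y u t = k u t * c u t
  cu : ∀ u t, t < 0 → du c u t = -(v u t * k u t * s u t)
  su : ∀ u t, t < 0 → du s u t = v u t * k u t * c u t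

section evol
variable {x y v k c s : ℝ → ℝ → ℝ} (h : Fl x y v k c s)
include h

theorem Fl.vne (u t : ℝ) (ht : t < 0) : v u t ≠ 0 := (h.vpos u t ht).ne'

theorem Fl.unit_t (u t : ℝ) (ht : t < 0) :
    c u t * dt c u t + s u t * dt s u t = 0 := by
  have h1 : dt (fun u t => c u t * c u t + s u t * s u t) u t = 0 := by
    rw [dt_congr (G := fun _ _ => 1) (fun u t ht => by have := h.unit u t ht; nlinarith) u ht]
    simp [dt]
  have h2 : dt (fun u t => c u t * c u t + s u t * s u t) u t = _ :=
    (((h.sc.ht u ht).mul (h.sc.ht u ht)).add ((h.ss.ht u ht).mul (h.ss.ht u ht))).deriv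
  rw [h1] at h2
  linarith

theorem Fl.e1 (u t : ℝ) (ht : t < 0) :
    dt v u t * c u t + v u t * dt c u t = -(du k u t * s u t) - k u t * (v u t * k u t * c u t) := by
  have h1 := h.sx.comm u ht
  rw [dt_congr h.xu u ht, h.sv.dt_mul h.sc u ht, du_congr h.xt u ht,
    (h.sk.mul h.ss).du_neg u ht, h.sk.du_mul h.ss u ht, h.su u t ht] at h1
  linarith

theorem Fl.e2 (u t : ℝ) (ht : t < 0) :
    dt v u t * s u t + v u t * dt s u t = du k u t * c u t - k u t * (v u t * k u t * s u t) := by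
  have h1 := h.sy.comm u ht
  rw [dt_congr h.yu u ht, h.sv.dt_mul h.ss u ht, du_congr h.yt u ht,
    h.sk.du_mul h.sc u ht, h.cu u t ht] at h1
  linarith

theorem Fl.vt (u t : ℝ) (ht : t < 0) : dt v u t = -(k u t ^ 2 * v u t) := by
  have e1 := h.e1 u t ht
  have e2 := h.e2 u t ht
  have e3 := h.unit_t u t ht
  have e4 := h.unit u t ht
  linear_combination c u t * e1 + s u t * e2 - v u t * e3 - (dt v u t + k u t ^ 2 * v u t) * e4

theorem Fl.rot (u t : ℝ) (ht : t < 0) :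
    v u t * (c u t * dt s u t - s u t * dt c u t) = du k u t := by
  have e1 := h.e1 u t ht
  have e2 := h.e2 u t ht
  have e4 := h.unit u t ht
  linear_combination c u t * e2 - s u t * e1 + du k u t * e4

theorem Fl.ct (u t : ℝ) (ht : t < 0) : dt c u t = -(s u t * (du k u t / v u t)) := by
  have e1 := h.rot u t ht
  have e3 := h.unit_t u t ht
  have e4 := h.unit u t ht
  rw [← e1, mul_div_cancel_left₀ _ (h.vne u t ht)]
  linear_combination c u t * e3 - dt c u t * e4

theorem Fl.st (u t : ℝ) (ht : t < 0) : dt s u t = c u t * (du k u t / v u t) := by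
  have e1 := h.rot u t ht
  have e3 := h.unit_t u t ht
  have e4 := h.unit u t ht
  rw [← e1, mul_div_cancel_left₀ _ (h.vne u t ht)]
  linear_combination s u t * e3 - dt s u t * e4

theorem Fl.sL : Sm (fun u t => du k u t / v u t) := h.sk.du.div h.sv h.vne

/-- The evolution of the curvature density. -/
theorem Fl.bt (u t : ℝ) (ht : t < 0) :
    dt (fun u t => v u t * k u t) u t = du (fun u t => du k u t / v u t) u t := by
  have h1 := h.ss.comm u ht
  rw [du_congr h.st u ht, dt_congr h.su u ht, h.sc.du_mul h.sL u ht,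
    (h.sv.mul h.sk).dt_mul h.sc u ht, h.cu u t ht, h.ct u t ht] at h1
  have h2 := h.sc.comm u ht
  rw [du_congr h.ct u ht, dt_congr h.cu u ht, (h.ss.mul h.sL).du_neg u ht,
    h.ss.du_mul h.sL u ht,
    ((h.sv.mul h.sk).mul h.ss).dt_neg u ht,
    (h.sv.mul h.sk).dt_mul h.ss u ht, h.su u t ht, h.st u t ht] at h2
  have e4 := h.unit u t ht
  linear_combination -c u t * h1 + s u t * h2 +
    (du (fun u t => du k u t / v u t) u t - dt (fun u t => v u t * k u t) u t) * e4

end evol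

theorem mul_exp_neg_le_one (y : ℝ) : y * Real.exp (-y) ≤ 1 := by
  rw [Real.exp_neg, ← div_eq_mul_inv, div_le_one (Real.exp_pos y)]
  linarith [Real.add_one_le_exp y]

theorem alg_bound {R M h1 h2 k m p : ℝ} (hR : 0 < R) (hM1 : |h1| ≤ M)
    (hM2 : |h2| ≤ M) (hmp : m ^ 2 + p ^ 2 ≤ 2 * R ^ 2) :
    h1 * (2 * k * p / R ^ 2) + h2 * (4 * m ^ 2 / R ^ 4) + h1 * (2 / R ^ 2 * (1 + k * p))
      ≤ M / R ^ 2 * (10 + 8 * (R * |k|)) := by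
  have hp : |p| ≤ 2 * R := abs_le_of_sq_le_sq (by nlinarith [sq_nonneg m]) (by positivity)
  have hm : m ^ 2 ≤ 2 * R ^ 2 := by nlinarith [sq_nonneg p]
  have hM : 0 ≤ M := (abs_nonneg _).trans hM1
  have hkp : |k * p| ≤ 2 * (R * |k|) := by
    rw [abs_mul]; nlinarith [abs_nonneg k, mul_le_mul_of_nonneg_left hp (abs_nonneg k)]
  have e : h1 * (2 * k * p / R ^ 2) + h2 * (4 * m ^ 2 / R ^ 4) + h1 * (2 / R ^ 2 * (1 + k * p))
      = (h1 * (2 + 4 * (k * p)) + h2 * (4 * (m ^ 2 / R ^ 2))) / R ^ 2 := by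
    field_simp; ring
  rw [e, div_mul_eq_mul_div]
  refine div_le_div_of_nonneg_right ?_ (by positivity)
  have a1 : h1 * (2 + 4 * (k * p)) ≤ M * (2 + 8 * (R * |k|)) := by
    refine (le_abs_self _).trans ?_
    rw [abs_mul]
    refine mul_le_mul hM1 ?_ (abs_nonneg _) hM
    refine (abs_add_le _ _).trans ?_
    have e4 : |4 * (k * p)| = 4 * |k * p| := by rw [abs_mul]; norm_num
    have e2 : |(2:ℝ)| = 2 := by norm_num
    rw [e4, e2]; linarith
  have a2 : h2 * (4 * (m ^ 2 / R ^ 2)) ≤ M * 8 := by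
    have : 4 * (m ^ 2 / R ^ 2) ≤ 8 := by
      have : m ^ 2 / R ^ 2 ≤ 2 := by rw [div_le_iff₀ (by positivity)]; exact hm
      linarith
    refine (le_abs_self _).trans ?_
    rw [abs_mul, abs_of_nonneg (show 0 ≤ 4 * (m ^ 2 / R ^ 2) by positivity)]
    exact mul_le_mul hM2 this (by positivity) hM
  linarith

/-- The data of a smooth cutoff on the line. -/
structure Cut (h h1 h2 : ℝ → ℝ) (M : ℝ) : Prop where
  sm : ContDiff ℝ (⊤ : ℕ∞) h
  sm1 : ContDiff ℝ (⊤ : ℕ∞) h1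
  d1 : ∀ r, HasDerivAt h (h1 r) r
  d2 : ∀ r, HasDerivAt h1 (h2 r) r
  nn : ∀ r, 0 ≤ h r
  le : ∀ r, h r ≤ 1
  one : ∀ r, r ≤ 1 → h r = 1
  z : ∀ r, 2 < r → h r = 0
  z1 : ∀ r, 2 < r → h1 r = 0
  z2 : ∀ r, 2 < r → h2 r = 0
  b1 : ∀ r, |h1 r| ≤ M
  b2 : ∀ r, |h2 r| ≤ M

theorem bdd_aux {g : ℝ → ℝ} (hg : Continuous g) (h0 : ∀ r, r < 1 → g r = 0)
    (h2 : ∀ r, 2 < r → g r = 0) : ∃ M, ∀ r, |g r| ≤ M := by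
  obtain ⟨M, hM⟩ := (isCompact_Icc (a := (1:ℝ)) (b := 2)).exists_bound_of_continuousOn
    hg.continuousOn
  refine ⟨max M 0, fun r => ?_⟩
  rcases lt_or_ge r 1 with hr | hr
  · rw [h0 r hr]; simp
  · rcases lt_or_ge 2 r with hr2 | hr2
    · rw [h2 r hr2]; simp
    · exact (hM r ⟨hr, hr2⟩).trans (le_max_left _ _)

theorem exists_cut : ∃ h h1 h2 : ℝ → ℝ, ∃ M, Cut h h1 h2 M := by
  set h : ℝ → ℝ := fun r => Real.smoothTransition (2 - r) with hh
  have sm : ContDiff ℝ (⊤ : ℕ∞) h := Real.smoothTransition.contDiff.comp (by fun_prop)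
  have sm1 : ContDiff ℝ (⊤ : ℕ∞) (deriv h) := ((contDiff_infty_iff_deriv).1 sm).2
  have sm2 : ContDiff ℝ (⊤ : ℕ∞) (deriv (deriv h)) := ((contDiff_infty_iff_deriv).1 sm1).2
  have one : ∀ r, r ≤ 1 → h r = 1 := fun r hr =>
    Real.smoothTransition.one_of_one_le (by linarith)
  have z : ∀ r, 2 < r → h r = 0 := fun r hr =>
    Real.smoothTransition.zero_of_nonpos (by linarith)
  have key : ∀ (S : Set ℝ) (g : ℝ → ℝ) (b : ℝ), IsOpen S → (∀ r ∈ S, g r = b) →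
      ∀ r ∈ S, deriv g r = 0 := by
    intro S g b hS hg r hr
    have : g =ᶠ[𝓝 r] fun _ => b := by
      filter_upwards [hS.mem_nhds hr] with a ha using hg a ha
    rw [this.deriv_eq]; simp
  have z1 := key (Ioi 2) h 0 isOpen_Ioi z
  have o1 := key (Iio 1) h 1 isOpen_Iio (fun r hr => one r (le_of_lt hr))
  have z2 := key (Ioi 2) _ 0 isOpen_Ioi z1
  have o2 := key (Iio 1) _ 0 isOpen_Iio o1
  obtain ⟨M1, hM1⟩ := bdd_aux sm1.continuous o1 z1
  obtain ⟨M2, hM2⟩ := bdd_aux sm2.continuous o2 z2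
  exact ⟨h, deriv h, deriv (deriv h), max M1 M2,
    { sm := sm, sm1 := sm1
      d1 := fun r => (sm.differentiable (by simp) r).hasDerivAt
      d2 := fun r => (sm1.differentiable (by simp) r).hasDerivAt
      nn := fun r => Real.smoothTransition.nonneg _
      le := fun r => Real.smoothTransition.le_one _
      one := one, z := z, z1 := z1, z2 := z2
      b1 := fun r => (hM1 r).trans (le_max_left _ _)
      b2 := fun r => (hM2 r).trans (le_max_right _ _) }⟩

/-- The Gaussian weight `exp (-|γ|²/(4 l))`. -/
def gw (x y : ℝ → ℝ → ℝ) (l u t : ℝ) : ℝ := Real.exp (-(x u t ^ 2 + y u t ^ 2) / (4 * l))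

section core
variable {x y v k c s : ℝ → ℝ → ℝ} (F : Fl x y v k c s)
include F

theorem Fl.Dt (u t : ℝ) (ht : t < 0) : HasDerivAt (fun t => x u t ^ 2 + y u t ^ 2)
    (2 * k u t * (-(x u t * s u t) + y u t * c u t)) t := by
  have h1 := F.sx.ht u ht
  have h2 := F.sy.ht u ht
  rw [F.xt u t ht] at h1
  rw [F.yt u t ht] at h2
  exact ((h1.fun_pow 2).fun_add (h2.fun_pow 2)).congr_deriv (by push_cast; ring)

theorem Fl.Du (u t : ℝ) (ht : t < 0) : HasDerivAt (fun u => x u t ^ 2 + y u t ^ 2)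
    (2 * v u t * (x u t * c u t + y u t * s u t)) u := by
  have h1 := F.sx.hu u ht
  have h2 := F.sy.hu u ht
  rw [F.xu u t ht] at h1
  rw [F.yu u t ht] at h2
  exact ((h1.fun_pow 2).fun_add (h2.fun_pow 2)).congr_deriv (by push_cast; ring)

theorem Fl.mp (u t : ℝ) (ht : t < 0) :
    (x u t * c u t + y u t * s u t) ^ 2 + (-(x u t * s u t) + y u t * c u t) ^ 2
      = x u t ^ 2 + y u t ^ 2 := by
  linear_combination (x u t ^ 2 + y u t ^ 2) * F.unit u t ht

theorem Fl.mu (u t : ℝ) (ht : t < 0) : HasDerivAt (fun u => x u t * c u t + y u t * s u t)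
    (v u t * (1 + k u t * (-(x u t * s u t) + y u t * c u t))) u := by
  have h1 := F.sx.hu u ht
  have h2 := F.sy.hu u ht
  have h3 := F.sc.hu u ht
  have h4 := F.ss.hu u ht
  rw [F.xu u t ht] at h1
  rw [F.yu u t ht] at h2
  rw [F.cu u t ht] at h3
  rw [F.su u t ht] at h4
  exact ((h1.fun_mul h3).fun_add (h2.fun_mul h4)).congr_deriv
    (by linear_combination v u t * F.unit u t ht)

theorem Fl.sD : Sm (fun u t => x u t ^ 2 + y u t ^ 2) :=
  fun p hp => ((F.sx p hp).pow 2).add ((F.sy p hp).pow 2)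

theorem Fl.sgw (l : ℝ) : Sm (gw x y l) := by
  refine F.sD.comp (h := fun r => Real.exp (-r / (4 * l))) ?_
  fun_prop

theorem Fl.wt (l u t : ℝ) (ht : t < 0) : HasDerivAt (fun t => gw x y l u t)
    (gw x y l u t * (-(2 * k u t * (-(x u t * s u t) + y u t * c u t)) / (4 * l))) t :=
  ((F.Dt u t ht).neg.div_const (4 * l)).exp

theorem Fl.wvt (R u t : ℝ) (hR : 0 < R) (ht : t < 0) :
    dt (fun u t => gw x y (R ^ 2) u t * v u t) u t ≤
      v u t * (-(k u t ^ 2 * gw x y (R ^ 2) u t) / 2 + gw x y (2 * R ^ 2) u t / R ^ 2) := by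
  have h1 := F.sv.ht u ht
  rw [F.vt u t ht] at h1
  have h2 : dt (fun u t => gw x y (R ^ 2) u t * v u t) u t = _ := ((F.wt (R ^ 2) u t ht).mul h1).deriv
  rw [h2]
  set p := -(x u t * s u t) + y u t * c u t with hp
  have hpD : p ^ 2 ≤ x u t ^ 2 + y u t ^ 2 := by
    rw [← F.mp u t ht]; nlinarith [sq_nonneg (x u t * c u t + y u t * s u t)]
  have hv := F.vpos u t ht
  set w := gw x y (R ^ 2) u t with hw
  have hw0 : 0 < w := Real.exp_pos _
  set D := x u t ^ 2 + y u t ^ 2 with hD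
  have key : w * (p ^ 2 / (8 * R ^ 4)) ≤ gw x y (2 * R ^ 2) u t / R ^ 2 := by
    set w2 := gw x y (2 * R ^ 2) u t with hw2
    have e : w = w2 * Real.exp (-(D / (8 * R ^ 2))) := by
      rw [hw, hw2, gw, gw, ← Real.exp_add, ← hD]
      congr 1; field_simp; ring
    have h3 := mul_exp_neg_le_one (D / (8 * R ^ 2))
    have hw20 : 0 < w2 := Real.exp_pos _
    calc w * (p ^ 2 / (8 * R ^ 4)) ≤ w * (D / (8 * R ^ 4)) := by gcongr
      _ = w2 / R ^ 2 * (D / (8 * R ^ 2) * Real.exp (-(D / (8 * R ^ 2)))) := by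
        rw [e]; field_simp
      _ ≤ w2 / R ^ 2 * 1 := by gcongr
      _ = _ := by ring
  have e2 : -(2 * k u t * p) / (4 * R ^ 2) ≤ k u t ^ 2 / 2 + p ^ 2 / (8 * R ^ 4) := by
    have : k u t ^ 2 / 2 + p ^ 2 / (8 * R ^ 4) - -(2 * k u t * p) / (4 * R ^ 2)
      = (k u t + p / (2 * R ^ 2)) ^ 2 / 2 := by field_simp; ring
    have := sq_nonneg (k u t + p / (2 * R ^ 2))
    linarith
  have e3 := mul_le_mul_of_nonneg_left e2 hw0.le
  have e4 : w * (-(2 * k u t * p) / (4 * R ^ 2)) - w * k u t ^ 2 ≤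
      -(k u t ^ 2 * w) / 2 + gw x y (2 * R ^ 2) u t / R ^ 2 := by linarith
  have e5 := mul_le_mul_of_nonneg_left e4 hv.le
  linarith

/-- Weighted length is almost monotone. -/
theorem Fl.A_mono {R K : ℝ} (hR : 0 < R) {α β : ℝ} (hab : α ≤ β)
    (hK : ∀ t < 0, ∫ u in α..β, gw x y (2 * R ^ 2) u t * v u t ≤ K) {a t : ℝ} (hat : a ≤ t)
    (ht : t < 0) :
    ∫ u in α..β, gw x y (R ^ 2) u t * v u t ≤
      (∫ u in α..β, gw x y (R ^ 2) u a * v u a) + K / R ^ 2 * (t - a) := by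
  have hS : Sm (fun u t => gw x y (R ^ 2) u t * v u t) := (F.sgw _).mul F.sv
  have hd := fun τ (hτ : τ < 0) => hS.hasDerivAt_integral α β hτ
  have hneg : ∀ τ ∈ Icc a t, τ < 0 := fun τ hτ => lt_of_le_of_lt hτ.2 ht
  refine sub_le_iff_le_add'.1 (Convex.image_sub_le_mul_sub_of_deriv_le (convex_Icc a t)
    (f := fun τ => ∫ u in α..β, gw x y (R ^ 2) u τ * v u τ) ?_ ?_ ?_ a (left_mem_Icc.2 hat) t
    (right_mem_Icc.2 hat) hat)
  · exact fun τ hτ => (hd τ (hneg τ hτ)).continuousAt.continuousWithinAt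
  · exact fun τ hτ => (hd τ (hneg τ (interior_subset hτ))).differentiableAt.differentiableWithinAt
  · intro τ hτ
    have h0 := hneg τ (interior_subset hτ)
    rw [(hd τ h0).deriv]
    calc ∫ u in α..β, dt (fun u t => gw x y (R ^ 2) u t * v u t) u τ
        ≤ ∫ u in α..β, (gw x y (2 * R ^ 2) u τ * v u τ) / R ^ 2 := by
          refine intervalIntegral.integral_mono_on hab ((hS.dt.cont_u h0).intervalIntegrable _ _)
            (((((F.sgw _).mul F.sv).cont_u h0).div_const _).intervalIntegrable _ _) ?_
          intro u _
          refine (F.wvt R u τ hR h0).trans ?_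
          have hv := F.vpos u τ h0
          have : 0 ≤ v u τ * (k u τ ^ 2 * gw x y (R ^ 2) u τ) :=
            mul_nonneg hv.le (mul_nonneg (sq_nonneg _) (Real.exp_pos _).le)
          have e : v u τ * (-(k u τ ^ 2 * gw x y (R ^ 2) u τ) / 2 + gw x y (2 * R ^ 2) u τ / R ^ 2)
            = (gw x y (2 * R ^ 2) u τ * v u τ) / R ^ 2
              - v u τ * (k u τ ^ 2 * gw x y (R ^ 2) u τ) / 2 := by ring
          rw [e]; linarith
      _ = (∫ u in α..β, gw x y (2 * R ^ 2) u τ * v u τ) / R ^ 2 := by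
          rw [intervalIntegral.integral_div]
      _ ≤ K / R ^ 2 := by gcongr; exact hK τ h0

end core

theorem alg_main {f f1 f2 k ku kt Lu v G m p R : ℝ} (hG : 0 < G) (hGk : k ^ 2 ≤ G ^ 2)
    (hv : 0 < v) (hR : 0 < R) (hf : 0 ≤ f) (hkt : -(k ^ 2 * v) * k + v * kt = Lu) :
    f1 * (2 * k * p / R ^ 2) * (v * G) + f * (-(k ^ 2 * v) * G + v * (k * kt / G)) ≤
    (((f1 * (2 * v * m / R ^ 2) * (k / G) + f * ((ku * G - k * (k * ku / G)) / G ^ 2)) * (ku / v)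
      + f * (k / G) * Lu) - ((f2 * (2 * v * m / R ^ 2) * (2 * m / R ^ 2)
        + f1 * (2 * (v * (1 + k * p)) / R ^ 2)) * G + f1 * (2 * m / R ^ 2) * (k * ku / G)))
      + v * G * (f1 * (2 * k * p / R ^ 2) + f2 * (4 * m ^ 2 / R ^ 4)
        + f1 * (2 / R ^ 2 * (1 + k * p))) := by
  have h1 : 0 ≤ f * (ku ^ 2 * (G ^ 2 - k ^ 2) / (G ^ 3 * v)) + f * (v * k ^ 2 * (G ^ 2 - k ^ 2) / G) := by
    have : 0 ≤ G ^ 2 - k ^ 2 := by linarith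
    positivity
  rw [← sub_nonneg]
  refine h1.trans (le_of_eq ?_)
  rw [← hkt]
  field_simp
  ring

theorem alg_bound2 {R M E k G v w : ℝ} (hR : 0 < R) (hM : 0 ≤ M) (hv : 0 < v) (hG : 0 ≤ G)
    (hGk : G ≤ |k| + 1 / R) (hw : 1 / 2 ≤ w)
    (hE : E ≤ M / R ^ 2 * (10 + 8 * (R * |k|))) :
    v * G * E ≤ 40 * M / R ^ 3 * (1 + R ^ 2 * k ^ 2) * (w * v) := by
  have e1 : v * G * E ≤ v * (|k| + 1 / R) * (M / R ^ 2 * (10 + 8 * (R * |k|))) := by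
    have hk := abs_nonneg k
    calc v * G * E ≤ v * G * (M / R ^ 2 * (10 + 8 * (R * |k|))) := by gcongr
      _ ≤ _ := by gcongr
  have e2 : v * (|k| + 1 / R) * (M / R ^ 2 * (10 + 8 * (R * |k|)))
      = M / R ^ 3 * v * ((R * |k| + 1) * (10 + 8 * (R * |k|))) := by
    field_simp
  have e3 : (R * |k| + 1) * (10 + 8 * (R * |k|)) ≤ 20 * (1 + R ^ 2 * k ^ 2) := by
    have : R ^ 2 * k ^ 2 = (R * |k|) ^ 2 := by rw [mul_pow, sq_abs]
    rw [this]
    nlinarith [sq_nonneg (R * |k| - 1)]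
  have e4 : 40 * M / R ^ 3 * (1 + R ^ 2 * k ^ 2) * (w * v) ≥
      40 * M / R ^ 3 * (1 + R ^ 2 * k ^ 2) * (1 / 2 * v) := by gcongr
  refine e1.trans (e2.le.trans (le_trans ?_ e4))
  calc M / R ^ 3 * v * ((R * |k| + 1) * (10 + 8 * (R * |k|)))
      ≤ M / R ^ 3 * v * (20 * (1 + R ^ 2 * k ^ 2)) := by gcongr
    _ = _ := by ring

/-- Regularized absolute curvature. -/
def Gf (k : ℝ → ℝ → ℝ) (R u t : ℝ) : ℝ := Real.sqrt (k u t ^ 2 + (1 / R) ^ 2)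

/-- The cutoff. -/
def cf (h : ℝ → ℝ) (x y : ℝ → ℝ → ℝ) (R u t : ℝ) : ℝ := h ((x u t ^ 2 + y u t ^ 2) / R ^ 2)

/-- The boundary term. -/
def Bf (h h1 : ℝ → ℝ) (x y v k c s : ℝ → ℝ → ℝ) (R u t : ℝ) : ℝ :=
  cf h x y R u t * (k u t / Gf k R u t) * (du k u t / v u t)
    - cf h1 x y R u t * (2 * (x u t * c u t + y u t * s u t) / R ^ 2) * Gf k R u t

set_option linter.unusedSectionVars false
section core2
variable {x y v k c s : ℝ → ℝ → ℝ} (F : Fl x y v k c s) {h h1 h2 : ℝ → ℝ} {M : ℝ}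
  (C : Cut h h1 h2 M) {R : ℝ} (hR : 0 < R)

theorem Gf_pos (hR : 0 < R) (u t : ℝ) : 0 < Gf k R u t := Real.sqrt_pos.2 (by positivity)
theorem Gf_sq (u t : ℝ) : Gf k R u t ^ 2 = k u t ^ 2 + (1 / R) ^ 2 :=
  Real.sq_sqrt (by positivity)
theorem Gf_le (hR : 0 < R) (u t : ℝ) : Gf k R u t ≤ |k u t| + 1 / R := by
  refine Real.sqrt_le_iff.2 ⟨by positivity, ?_⟩
  have : 0 ≤ |k u t| * (1 / R) := by positivity
  nlinarith [sq_abs (k u t)]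
theorem le_Gf (u t : ℝ) : |k u t| ≤ Gf k R u t := by
  refine Real.le_sqrt_of_sq_le ?_
  rw [sq_abs]; nlinarith [sq_nonneg (1 / R)]

theorem Cut.M_nonneg (C : Cut h h1 h2 M) : 0 ≤ M := (abs_nonneg _).trans (C.b1 0)

include hR in
theorem gw_half (u t : ℝ) (hD : (x u t ^ 2 + y u t ^ 2) / R ^ 2 ≤ 2) :
    1 / 2 ≤ gw x y (R ^ 2) u t := by
  have e : -(x u t ^ 2 + y u t ^ 2) / (4 * R ^ 2) = -((x u t ^ 2 + y u t ^ 2) / R ^ 2) / 4 := by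
    field_simp
  rw [gw, e]
  have := Real.add_one_le_exp (-((x u t ^ 2 + y u t ^ 2) / R ^ 2) / 4)
  linarith

include F hR

theorem Fl.sG : Sm (Gf k R) := by
  have h0 : Sm (fun u t => k u t ^ 2 + (1 / R) ^ 2) :=
    fun p hp => ((F.sk p hp).pow 2).add contDiffAt_const
  exact h0.sqrt fun u t _ => by positivity

theorem Fl.Gu (u t : ℝ) (ht : t < 0) : HasDerivAt (fun u => Gf k R u t)
    (k u t * du k u t / Gf k R u t) u := by
  have h0 : k u t ^ 2 + (1 / R) ^ 2 ≠ 0 := by positivity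
  have h1 := ((F.sk.hu u ht).fun_pow 2).add_const ((1 / R) ^ 2)
  have hG := (Gf_pos (k := k) hR u t).ne'
  refine (h1.sqrt h0).congr_deriv ?_
  change _ / (2 * Gf k R u t) = _
  field_simp; norm_num; ring

theorem Fl.Gt (u t : ℝ) (ht : t < 0) : HasDerivAt (fun t => Gf k R u t)
    (k u t * dt k u t / Gf k R u t) t := by
  have h0 : k u t ^ 2 + (1 / R) ^ 2 ≠ 0 := by positivity
  have h1 := ((F.sk.ht u ht).fun_pow 2).add_const ((1 / R) ^ 2)
  have hG := (Gf_pos (k := k) hR u t).ne'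
  refine (h1.sqrt h0).congr_deriv ?_
  change _ / (2 * Gf k R u t) = _
  field_simp; norm_num; ring

theorem Fl.scf {g : ℝ → ℝ} (hg : ContDiff ℝ (⊤ : ℕ∞) g) : Sm (cf g x y R) := by
  refine F.sD.comp (h := fun r => g (r / R ^ 2)) ?_
  exact hg.comp (by fun_prop)

theorem Fl.cft {g g1 : ℝ → ℝ} (hg : ∀ r, HasDerivAt g (g1 r) r) (u t : ℝ) (ht : t < 0) :
    HasDerivAt (fun t => cf g x y R u t)
      (cf g1 x y R u t * (2 * k u t * (-(x u t * s u t) + y u t * c u t) / R ^ 2)) t :=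
  (hg _).comp t ((F.Dt u t ht).div_const (R ^ 2))

theorem Fl.cfu {g g1 : ℝ → ℝ} (hg : ∀ r, HasDerivAt g (g1 r) r) (u t : ℝ) (ht : t < 0) :
    HasDerivAt (fun u => cf g x y R u t)
      (cf g1 x y R u t * (2 * v u t * (x u t * c u t + y u t * s u t) / R ^ 2)) u :=
  (hg _).comp u ((F.Du u t ht).div_const (R ^ 2))

include C

theorem Fl.sB : Sm (Bf h h1 x y v k c s R) := by
  have hG := F.sG hR
  have hG0 : ∀ u t, t < 0 → Gf k R u t ≠ 0 := fun u t _ => (Gf_pos hR u t).ne'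
  have hm : Sm (fun u t => 2 * (x u t * c u t + y u t * s u t) / R ^ 2) := by
    intro p hp
    exact (contDiffAt_const.mul (((F.sx p hp).mul (F.sc p hp)).add
      ((F.sy p hp).mul (F.ss p hp)))).div_const _
  exact (((F.scf hR C.sm).mul (F.sk.div hG hG0)).mul F.sL).sub (((F.scf hR C.sm1).mul hm).mul hG)

theorem Fl.main_pt (u t : ℝ) (ht : t < 0) :
    dt (fun u t => cf h x y R u t * (v u t * Gf k R u t)) u t ≤
      du (Bf h h1 x y v k c s R) u t +
        40 * M / R ^ 3 * (1 + R ^ 2 * k u t ^ 2) * (gw x y (R ^ 2) u t * v u t) := by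
  have hG := Gf_pos (k := k) hR u t
  have hv := F.vpos u t ht
  have hvt := F.sv.ht u ht
  rw [F.vt u t ht] at hvt
  have d1 : dt (fun u t => cf h x y R u t * (v u t * Gf k R u t)) u t = _ :=
    ((F.cft hR C.d1 u t ht).mul (hvt.mul (F.Gt hR u t ht))).deriv
  have hm : HasDerivAt (fun u => 2 * (x u t * c u t + y u t * s u t) / R ^ 2) _ u :=
    ((F.mu u t ht).const_mul 2).div_const (R ^ 2)
  have d2 : du (Bf h h1 x y v k c s R) u t = _ :=
    ((((F.cfu hR C.d1 u t ht).mul ((F.sk.hu u ht).div (F.Gu hR u t ht) hG.ne')).mul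
      (F.sL.hu u ht)).sub (((F.cfu hR C.d2 u t ht).mul hm).mul (F.Gu hR u t ht))).deriv
  have hkt : -(k u t ^ 2 * v u t) * k u t + v u t * dt k u t =
      du (fun u t => du k u t / v u t) u t := by
    rw [← F.bt u t ht, F.sv.dt_mul F.sk u ht, F.vt u t ht]
  have hmain := alg_main (f1 := cf h1 x y R u t) (f2 := cf h2 x y R u t) (ku := du k u t)
    (m := x u t * c u t + y u t * s u t) (p := -(x u t * s u t) + y u t * c u t)
    hG (by rw [Gf_sq]; nlinarith [sq_nonneg (1 / R)]) hv hR
    (C.nn ((x u t ^ 2 + y u t ^ 2) / R ^ 2)) hkt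
  have hw0 : 0 < gw x y (R ^ 2) u t := Real.exp_pos _
  have hM := C.M_nonneg
  have hE : v u t * Gf k R u t * (cf h1 x y R u t * (2 * k u t * (-(x u t * s u t) + y u t * c u t) / R ^ 2)
      + cf h2 x y R u t * (4 * (x u t * c u t + y u t * s u t) ^ 2 / R ^ 4)
        + cf h1 x y R u t * (2 / R ^ 2 * (1 + k u t * (-(x u t * s u t) + y u t * c u t)))) ≤
      40 * M / R ^ 3 * (1 + R ^ 2 * k u t ^ 2) * (gw x y (R ^ 2) u t * v u t) := by
    rcases lt_or_ge 2 ((x u t ^ 2 + y u t ^ 2) / R ^ 2) with hD | hD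
    · rw [cf, cf, C.z1 _ hD, C.z2 _ hD]
      simp only [zero_mul, add_zero, mul_zero]
      positivity
    · refine alg_bound2 hR hM hv hG.le (Gf_le hR u t) (gw_half hR u t hD) ?_
      refine alg_bound hR (C.b1 _) (C.b2 _) ?_
      rw [F.mp u t ht]
      rwa [div_le_iff₀ (by positivity)] at hD
  rw [d1, d2]
  exact (hmain.trans (add_le_add_right hE _))

theorem Fl.fQ_le (u t : ℝ) (ht : t < 0) :
    cf h x y R u t * (v u t * Gf k R u t) ≤
      4 / R * (1 + R ^ 2 * k u t ^ 2) * (gw x y (R ^ 2) u t * v u t) := by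
  have hG := Gf_pos (k := k) hR u t
  have hv := F.vpos u t ht
  have hw0 : 0 < gw x y (R ^ 2) u t := Real.exp_pos _
  rcases lt_or_ge 2 ((x u t ^ 2 + y u t ^ 2) / R ^ 2) with hD | hD
  · rw [cf, C.z _ hD, zero_mul]
    positivity
  · have h1 := C.le ((x u t ^ 2 + y u t ^ 2) / R ^ 2)
    have h2 := gw_half hR u t hD
    calc cf h x y R u t * (v u t * Gf k R u t) ≤ 1 * (v u t * (|k u t| + 1 / R)) := by
          refine mul_le_mul h1 ?_ (by positivity) zero_le_one
          exact mul_le_mul_of_nonneg_left (Gf_le hR u t) hv.le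
      _ = 1 / R * v u t * (R * |k u t| + 1) := by field_simp
      _ ≤ 1 / R * v u t * (2 * (1 + R ^ 2 * k u t ^ 2)) := by
          have : R ^ 2 * k u t ^ 2 = (R * |k u t|) ^ 2 := by rw [mul_pow, sq_abs]
          rw [this]
          gcongr
          nlinarith [sq_nonneg (R * |k u t| - 1)]
      _ = 4 / R * (1 + R ^ 2 * k u t ^ 2) * (1 / 2 * v u t) := by ring
      _ ≤ _ := by gcongr

/-- The main integrated estimate. -/
theorem Fl.main_int {K K2 U a t : ℝ} (hU : 0 ≤ U) (hat : a ≤ t) (ht : t < 0)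
    (haR : t - a ≤ R ^ 2)
    (hK : ∀ t < 0, ∫ u in (-U)..U, gw x y (2 * R ^ 2) u t * v u t ≤ K)
    (hK2 : ∫ u in (-U)..U, gw x y (R ^ 2) u a * v u a ≤ K2)
    (hend : ∀ τ ∈ Icc a t, 2 < (x U τ ^ 2 + y U τ ^ 2) / R ^ 2 ∧
      2 < (x (-U) τ ^ 2 + y (-U) τ ^ 2) / R ^ 2) :
    (t - a) * ∫ u in (-U)..U, cf h x y R u t * (v u t * Gf k R u t) ≤
      2 * (4 + 40 * M) * R * K2 + 3 * (4 + 40 * M) / R * K * (t - a) := by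
  set c0 := 4 + 40 * M with hc0
  have hM := C.M_nonneg
  have hab : -U ≤ U := by linarith
  have sQ : Sm (fun u t => cf h x y R u t * (v u t * Gf k R u t)) :=
    (F.scf hR C.sm).mul (F.sv.mul (F.sG hR))
  have sW : Sm (fun u t => gw x y (R ^ 2) u t * v u t) := (F.sgw _).mul F.sv
  have sW2 : Sm (fun u t => gw x y (2 * R ^ 2) u t * v u t) := (F.sgw _).mul F.sv
  have sP : Sm (fun u t => (t - a) * (cf h x y R u t * (v u t * Gf k R u t)) +
    2 * c0 * R * (gw x y (R ^ 2) u t * v u t)) :=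
    ((Sm.tvar.sub (Sm.const a)).mul sQ).add ((Sm.const _).mul sW)
  set P := (fun u t => (t - a) * (cf h x y R u t * (v u t * Gf k R u t)) +
    2 * c0 * R * (gw x y (R ^ 2) u t * v u t)) with hP
  have hd := fun τ (hτ : τ < 0) => sP.hasDerivAt_integral (-U) U hτ
  have hneg : ∀ τ ∈ Icc a t, τ < 0 := fun τ hτ => lt_of_le_of_lt hτ.2 ht
  have hfin := Convex.image_sub_le_mul_sub_of_deriv_le (convex_Icc a t)
    (f := fun τ => ∫ u in (-U)..U, P u τ) (C := 3 * c0 / R * K)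
    (fun τ hτ => (hd τ (hneg τ hτ)).continuousAt.continuousWithinAt)
    (fun τ hτ => (hd τ (hneg τ (interior_subset hτ))).differentiableAt.differentiableWithinAt)
    (by
      intro τ hτ
      have hτ' := interior_subset hτ
      have h0 := hneg τ hτ'
      rw [(hd τ h0).deriv]
      have sB := F.sB C hR
      have hB0 : ∫ u in (-U)..U, du (Bf h h1 x y v k c s R) u τ = 0 := by
        rw [intervalIntegral.integral_eq_sub_of_hasDerivAt (fun u _ => sB.hu u h0)
          ((sB.du.cont_u h0).intervalIntegrable _ _)]
        obtain ⟨e1, e2⟩ := hend τ hτ'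
        simp only [Bf, cf, C.z _ e1, C.z _ e2, C.z1 _ e1, C.z1 _ e2, zero_mul, sub_zero]
      calc ∫ u in (-U)..U, dt P u τ
          ≤ ∫ u in (-U)..U, ((τ - a) * du (Bf h h1 x y v k c s R) u τ +
              3 * c0 / R * (gw x y (2 * R ^ 2) u τ * v u τ)) := by
            refine intervalIntegral.integral_mono_on hab
              ((sP.dt.cont_u h0).intervalIntegrable _ _)
              (((continuous_const.mul (sB.du.cont_u h0)).add
                (continuous_const.mul (sW2.cont_u h0))).intervalIntegrable _ _) ?_
            intro u _
            have e1 : dt P u τ = _ := ((((hasDerivAt_id τ).sub_const a).mul (sQ.ht u h0)).add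
              ((sW.ht u h0).const_mul (2 * c0 * R))).deriv
            rw [e1]
            have b1 := F.main_pt C hR u τ h0
            have b2 := F.fQ_le C hR u τ h0
            have b3 := F.wvt R u τ hR h0
            have hv := F.vpos u τ h0
            have hw0 : 0 < gw x y (R ^ 2) u τ := Real.exp_pos _
            have hww : gw x y (R ^ 2) u τ ≤ gw x y (2 * R ^ 2) u τ := by
              refine Real.exp_le_exp.2 ?_
              rw [neg_div, neg_div, neg_le_neg_iff]
              gcongr
              nlinarith [sq_nonneg R]
            have ta : 0 ≤ τ - a := by linarith [hτ'.1]
            have ta2 : τ - a ≤ R ^ 2 := by linarith [hτ'.2]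
            have b1' := mul_le_mul_of_nonneg_left b1 ta
            have b4 : (τ - a) * (40 * M / R ^ 3 * (1 + R ^ 2 * k u τ ^ 2) *
                (gw x y (R ^ 2) u τ * v u τ)) ≤ R ^ 2 * (40 * M / R ^ 3 *
                (1 + R ^ 2 * k u τ ^ 2) * (gw x y (R ^ 2) u τ * v u τ)) := by
              gcongr
            have b5 : R ^ 2 * (40 * M / R ^ 3 *
                (1 + R ^ 2 * k u τ ^ 2) * (gw x y (R ^ 2) u τ * v u τ))
                = 40 * M / R * (1 + R ^ 2 * k u τ ^ 2) * (gw x y (R ^ 2) u τ * v u τ) := by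
              field_simp
            have b3' := mul_le_mul_of_nonneg_left b3 (show 0 ≤ 2 * c0 * R by positivity)
            have b6 : 2 * c0 * R * (v u τ * (-(k u τ ^ 2 * gw x y (R ^ 2) u τ) / 2 +
                gw x y (2 * R ^ 2) u τ / R ^ 2)) =
                2 * c0 / R * (gw x y (2 * R ^ 2) u τ * v u τ)
                  - c0 * R * k u τ ^ 2 * (gw x y (R ^ 2) u τ * v u τ) := by
              field_simp; ring
            have b7 : 4 / R * (1 + R ^ 2 * k u τ ^ 2) * (gw x y (R ^ 2) u τ * v u τ) +
                40 * M / R * (1 + R ^ 2 * k u τ ^ 2) * (gw x y (R ^ 2) u τ * v u τ) =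
                c0 / R * (gw x y (R ^ 2) u τ * v u τ)
                  + c0 * R * k u τ ^ 2 * (gw x y (R ^ 2) u τ * v u τ) := by
              rw [hc0]; field_simp
            have b8 : c0 / R * (gw x y (R ^ 2) u τ * v u τ) ≤
                c0 / R * (gw x y (2 * R ^ 2) u τ * v u τ) := by gcongr
            have b9 : c0 / R * (gw x y (2 * R ^ 2) u τ * v u τ) +
                2 * c0 / R * (gw x y (2 * R ^ 2) u τ * v u τ) =
                3 * c0 / R * (gw x y (2 * R ^ 2) u τ * v u τ) := by ring
            simp only [id] at *
            linarith
        _ = (τ - a) * (∫ u in (-U)..U, du (Bf h h1 x y v k c s R) u τ) +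
              3 * c0 / R * ∫ u in (-U)..U, gw x y (2 * R ^ 2) u τ * v u τ := by
            rw [intervalIntegral.integral_add
              (((sB.du.cont_u h0).intervalIntegrable _ _).const_mul _)
              (((sW2.cont_u h0).intervalIntegrable _ _).const_mul _),
              intervalIntegral.integral_const_mul, intervalIntegral.integral_const_mul]
        _ ≤ 3 * c0 / R * K := by
            rw [hB0, mul_zero, zero_add]
            exact mul_le_mul_of_nonneg_left (hK τ h0) (by positivity))
    a (left_mem_Icc.2 hat) t (right_mem_Icc.2 hat) hat
  have ea : ∫ u in (-U)..U, P u a = 2 * c0 * R * ∫ u in (-U)..U, gw x y (R ^ 2) u a * v u a := by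
    rw [← intervalIntegral.integral_const_mul]
    simp [hP]
  have et : (t - a) * ∫ u in (-U)..U, cf h x y R u t * (v u t * Gf k R u t) ≤
      ∫ u in (-U)..U, P u t := by
    rw [← intervalIntegral.integral_const_mul]
    refine intervalIntegral.integral_mono_on hab
      ((continuous_const.mul (sQ.cont_u ht)).intervalIntegrable _ _)
      ((sP.cont_u ht).intervalIntegrable _ _) ?_
    intro u _
    have hv := F.vpos u t ht
    have hw0 : 0 < gw x y (R ^ 2) u t := Real.exp_pos _
    have : 0 ≤ 2 * c0 * R * (gw x y (R ^ 2) u t * v u t) := by positivity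
    simp only [hP]
    linarith
  have := mul_le_mul_of_nonneg_left hK2 (show 0 ≤ 2 * c0 * R by positivity)
  rw [ea] at hfin
  linarith

end core2

section core3
variable {x y v k c s : ℝ → ℝ → ℝ} (F : Fl x y v k c s) {R : ℝ} (hR : 0 < R)
include F hR

theorem Fl.seg {α β t : ℝ} (hab : α ≤ β) (ht : t < 0) :
    R * |gw x y (R ^ 2 / 2) β t - gw x y (R ^ 2 / 2) α t| ≤
      ∫ u in α..β, gw x y (R ^ 2) u t * v u t := by
  have hd : ∀ u, HasDerivAt (fun u => gw x y (R ^ 2 / 2) u t)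
    (gw x y (R ^ 2 / 2) u t * (-(2 * v u t * (x u t * c u t + y u t * s u t)) / (4 * (R ^ 2 / 2)))) u :=
    fun u => ((F.Du u t ht).neg.div_const (4 * (R ^ 2 / 2))).exp
  have sw := F.sgw (R ^ 2 / 2)
  have heq : ∀ u, du (gw x y (R ^ 2 / 2)) u t = _ := fun u => (hd u).deriv
  have sW : Sm (fun u t => gw x y (R ^ 2) u t * v u t) := (F.sgw _).mul F.sv
  rw [← intervalIntegral.integral_eq_sub_of_hasDerivAt (fun u _ => sw.hu u ht)
          ((sw.du.cont_u ht).intervalIntegrable _ _)]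
  have h1 : |∫ u in α..β, du (gw x y (R ^ 2 / 2)) u t| ≤
      ∫ u in α..β, (gw x y (R ^ 2) u t * v u t) / R := by
    have hi : IntervalIntegrable (fun u => (gw x y (R ^ 2) u t * v u t) / R) volume α β :=
      ((sW.cont_u ht).div_const _).intervalIntegrable _ _
    rw [← Real.norm_eq_abs]
    refine intervalIntegral.norm_integral_le_of_norm_le hab (Eventually.of_forall fun u _ => ?_) hi
    rw [heq u, Real.norm_eq_abs]
    have hv := F.vpos u t ht
    set m := x u t * c u t + y u t * s u t with hm
    set D := x u t ^ 2 + y u t ^ 2 with hD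
    have hmD : m ^ 2 ≤ D := by
      rw [hD, ← F.mp u t ht]; nlinarith [sq_nonneg (-(x u t * s u t) + y u t * c u t)]
    set w := gw x y (R ^ 2) u t with hw
    have hw0 : 0 < w := Real.exp_pos _
    have e1 : gw x y (R ^ 2 / 2) u t = w * Real.exp (-(D / (4 * R ^ 2))) := by
      rw [hw, gw, gw, ← Real.exp_add]; congr 1; field_simp; ring
    have e2 : |m| / R * Real.exp (-(D / (4 * R ^ 2))) ≤ 1 := by
      rw [Real.exp_neg, ← div_eq_mul_inv, div_le_one (Real.exp_pos _)]
      have a1 := Real.add_one_le_exp (D / (4 * R ^ 2))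
      have a2 : (|m| / R) ^ 2 / 4 ≤ D / (4 * R ^ 2) := by
        rw [div_pow, sq_abs, div_div, mul_comm (R ^ 2) 4]; gcongr
      nlinarith [sq_nonneg (|m| / R - 2)]
    have e3 : |gw x y (R ^ 2 / 2) u t * (-(2 * v u t * m) / (4 * (R ^ 2 / 2)))| =
        w * v u t / R * (|m| / R * Real.exp (-(D / (4 * R ^ 2)))) := by
      rw [e1, abs_mul, abs_mul, abs_of_pos hw0, abs_of_pos (Real.exp_pos _), abs_div, abs_neg,
        abs_mul, abs_mul, abs_of_pos hv, abs_of_pos (show 0 < 4 * (R ^ 2 / 2) by positivity),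
        abs_of_pos (show (0:ℝ) < 2 by norm_num)]
      field_simp; try ring
    rw [e3]
    calc _ ≤ w * v u t / R * 1 := by gcongr
      _ = _ := by ring
  rw [intervalIntegral.integral_div, le_div_iff₀ hR] at h1
  linarith

theorem Fl.seg2 {α β t : ℝ} (hab : α ≤ β) (ht : t < 0)
    (h : ((x α t ^ 2 + y α t ^ 2) / R ^ 2 ≤ 2 ∧ 4 ≤ (x β t ^ 2 + y β t ^ 2) / R ^ 2) ∨
      ((x β t ^ 2 + y β t ^ 2) / R ^ 2 ≤ 2 ∧ 4 ≤ (x α t ^ 2 + y α t ^ 2) / R ^ 2)) :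
    R / 5 ≤ ∫ u in α..β, gw x y (R ^ 2) u t * v u t := by
  refine le_trans ?_ (F.seg hR hab ht)
  have e : ∀ u, gw x y (R ^ 2 / 2) u t = Real.exp (-((x u t ^ 2 + y u t ^ 2) / R ^ 2) / 2) := by
    intro u; rw [gw]; congr 1; field_simp; ring
  have lo : ∀ u, (x u t ^ 2 + y u t ^ 2) / R ^ 2 ≤ 2 → Real.exp (-1) ≤ gw x y (R ^ 2 / 2) u t := by
    intro u hu; rw [e]; apply Real.exp_le_exp.2; linarith
  have hi : ∀ u, 4 ≤ (x u t ^ 2 + y u t ^ 2) / R ^ 2 → gw x y (R ^ 2 / 2) u t ≤ Real.exp (-2) := by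
    intro u hu; rw [e]; apply Real.exp_le_exp.2; linarith
  have num : 1 / 5 ≤ Real.exp (-1) - Real.exp (-2) := by
    have h2 : Real.exp (-2) = Real.exp (-1) * Real.exp (-1) := by rw [← Real.exp_add]; norm_num
    have h1 : Real.exp 1 * Real.exp (-1) = 1 := by rw [← Real.exp_add]; norm_num
    have a1 := Real.exp_one_gt_d9
    have a2 := Real.exp_one_lt_d9
    have a0 := Real.exp_pos (-1)
    have b1 : Real.exp (-1) ≤ 0.4 := by nlinarith
    have b2 : 0.36 ≤ Real.exp (-1) := by nlinarith
    rw [h2]; nlinarith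
  have : 1 / 5 ≤ |gw x y (R ^ 2 / 2) β t - gw x y (R ^ 2 / 2) α t| := by
    rcases h with ⟨h1, h2⟩ | ⟨h1, h2⟩
    · rw [abs_sub_comm]
      refine le_trans ?_ (le_abs_self _)
      linarith [lo _ h1, hi _ h2]
    · refine le_trans ?_ (le_abs_self _)
      linarith [lo _ h1, hi _ h2]
  nlinarith

theorem Fl.est {h h1 h2 : ℝ → ℝ} {M : ℝ} (C : Cut h h1 h2 M) {E : ℝ} (hE0 : 0 ≤ E)
    (hE : ∀ t < 0, ∀ l > 0, ∀ α β, α ≤ β →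
      ∫ u in α..β, gw x y l u t * v u t ≤ E * Real.sqrt (4 * π * l))
    (hInt : ∀ t < 0, Integrable (fun u => gw x y (R ^ 2) u t * v u t))
    (htop : ∀ t < 0, Tendsto (fun u => x u t ^ 2 + y u t ^ 2) atTop atTop)
    (hbot : ∀ t < 0, Tendsto (fun u => x u t ^ 2 + y u t ^ 2) atBot atTop)
    {t : ℝ} (ht : t < 0) :
    ∀ᶠ U in atTop, ∫ u in (-U)..U, cf h x y R u t * (v u t * Gf k R u t) ≤
      12 * (4 + 40 * M) * E * (1 + 120 * E) + 18 * (4 + 40 * M) * E := by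
  have hM := C.M_nonneg
  set θ := 1 / (1 + 120 * E) with hθ
  have hθ0 : 0 < θ := by positivity
  have hθ1 : θ ≤ 1 := by rw [hθ, div_le_one (by positivity)]; linarith
  have hθE : 6 * E * θ ≤ 1 / 20 := by
    rw [hθ, mul_one_div, div_le_iff₀ (by positivity)]; linarith
  set a := t - θ * R ^ 2 with ha
  have hR2 : 0 < R ^ 2 := by positivity
  have hat : a ≤ t := by rw [ha]; nlinarith [mul_pos hθ0 hR2]
  have ha0 : a < 0 := by linarith
  have hs1 : Real.sqrt (4 * π * (2 * R ^ 2)) ≤ 6 * R := by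
    refine Real.sqrt_le_iff.2 ⟨by positivity, ?_⟩
    nlinarith [Real.pi_lt_four]
  have hs2 : Real.sqrt (4 * π * (R ^ 2)) ≤ 6 * R := by
    refine Real.sqrt_le_iff.2 ⟨by positivity, ?_⟩
    nlinarith [Real.pi_lt_four]
  have hK : ∀ α β, α ≤ β → ∀ t < 0, ∫ u in α..β, gw x y (2 * R ^ 2) u t * v u t ≤ E * (6 * R) :=
    fun α β hab t ht => (hE t ht (2 * R ^ 2) (by positivity) α β hab).trans (by gcongr)
  have hpos : ∀ t < 0, ∀ u, 0 ≤ gw x y (R ^ 2) u t * v u t := fun t ht u =>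
    mul_nonneg (Real.exp_pos _).le (F.vpos u t ht).le
  have hlim := intervalIntegral_tendsto_integral (hInt a ha0)
    (tendsto_neg_atTop_atBot (G := ℝ)) tendsto_id
  set I := ∫ u, gw x y (R ^ 2) u a * v u a with hI
  have hev : ∀ᶠ U in atTop, I - R / 20 < ∫ u in (-U)..U, gw x y (R ^ 2) u a * v u a :=
    hlim.eventually (lt_mem_nhds (by linarith))
  have hle : ∀ α β, α ≤ β → ∫ u in α..β, gw x y (R ^ 2) u a * v u a ≤ I := by
    intro α β hab
    rw [intervalIntegral.integral_of_le hab]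
    exact setIntegral_le_integral (hInt a ha0) (Eventually.of_forall (hpos a ha0))
  have hii : ∀ α β, IntervalIntegrable (fun u => gw x y (R ^ 2) u a * v u a) volume α β :=
    fun α β => (hInt a ha0).intervalIntegrable
  filter_upwards [hev, eventually_ge_atTop 0] with U hU hU0
  have far : ∀ α β, α ≤ β → (∫ u in α..β, gw x y (R ^ 2) u a * v u a < R / 20) →
      ∀ τ ∈ Icc a t, ∫ u in α..β, gw x y (R ^ 2) u τ * v u τ < R / 5 := by
    intro α β hab hs τ hτ
    have hτ0 : τ < 0 := lt_of_le_of_lt hτ.2 ht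
    have h1 := F.A_mono hR hab (hK α β hab) hτ.1 hτ0
    have h2 : E * (6 * R) / R ^ 2 * (τ - a) ≤ E * (6 * R) / R ^ 2 * (θ * R ^ 2) := by
      gcongr; linarith [hτ.2]
    have h3 : E * (6 * R) / R ^ 2 * (θ * R ^ 2) = 6 * E * θ * R := by field_simp
    have h4 : 6 * E * θ * R ≤ 1 / 20 * R := by gcongr
    linarith
  have hend : ∀ τ ∈ Icc a t, 2 < (x U τ ^ 2 + y U τ ^ 2) / R ^ 2 ∧
      2 < (x (-U) τ ^ 2 + y (-U) τ ^ 2) / R ^ 2 := by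
    intro τ hτ
    have hτ0 : τ < 0 := lt_of_le_of_lt hτ.2 ht
    constructor
    · by_contra! hcon
      obtain ⟨β, hβ, hUβ⟩ := (((htop τ hτ0).eventually_ge_atTop (4 * R ^ 2)).and
        (eventually_ge_atTop U)).exists
      have h1 := F.seg2 hR hUβ hτ0 (Or.inl ⟨hcon, by rwa [le_div_iff₀ hR2]⟩)
      have h2 := far U β hUβ (by
        have e := intervalIntegral.integral_add_adjacent_intervals (hii (-U) U) (hii U β)
        have := hle (-U) β (by linarith)
        linarith) τ hτ
      linarith
    · by_contra! hcon
      obtain ⟨β, hβ, hUβ⟩ := (((hbot τ hτ0).eventually_ge_atTop (4 * R ^ 2)).and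
        (eventually_le_atBot (-U))).exists
      have h1 := F.seg2 hR hUβ hτ0 (Or.inr ⟨hcon, by rwa [le_div_iff₀ hR2]⟩)
      have h2 := far β (-U) hUβ (by
        have e := intervalIntegral.integral_add_adjacent_intervals (hii β (-U)) (hii (-U) U)
        have := hle β U (by linarith)
        linarith) τ hτ
      linarith
  have hta : t - a = θ * R ^ 2 := by rw [ha]; ring
  have hab : -U ≤ U := by linarith
  have hm := F.main_int C hR hU0 hat ht (by rw [hta]; nlinarith)
    (hK (-U) U hab) (K2 := E * (6 * R))
    ((hE a ha0 (R ^ 2) hR2 (-U) U hab).trans (by gcongr)) hend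
  rw [hta] at hm
  have hθi : 1 + 120 * E = 1 / θ := by rw [hθ, one_div_one_div]
  rw [hθi]
  refine le_of_mul_le_mul_left (hm.trans (le_of_eq ?_)) (mul_pos hθ0 hR2)
  field_simp
  ring

end core3

section bdry

/-- Smoothness on the closed half-plane `t ≤ 0`. -/
def Sb {E : Type} [NormedAddCommGroup E] [NormedSpace ℝ E] (F : ℝ → ℝ → E) : Prop :=
  ContDiffOn ℝ (⊤ : ℕ∞) (fun p : ℝ × ℝ => F p.1 p.2) (univ ×ˢ Iic (0:ℝ))

variable {E : Type} [NormedAddCommGroup E] [NormedSpace ℝ E]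

theorem uniq_half : UniqueDiffOn ℝ ((univ : Set ℝ) ×ˢ Iic (0:ℝ)) :=
  uniqueDiffOn_univ.prod (uniqueDiffOn_Iic 0)

theorem Sb.sm {F : ℝ → ℝ → E} (h : Sb F) : Sm F := by
  intro p hp
  refine h.contDiffAt ?_
  filter_upwards [ev_neg p hp] with q hq
  exact ⟨mem_univ _, le_of_lt hq⟩

theorem Sb.hu' {F : ℝ → ℝ → E} (h : Sb F) (u : ℝ) {t : ℝ} (ht : t ≤ 0) :
    HasDerivAt (fun v => F v t)
      (fderivWithin ℝ (fun p : ℝ × ℝ => F p.1 p.2) (univ ×ˢ Iic (0:ℝ)) (u, t) (1, 0)) u := by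
  have h1 : HasDerivWithinAt (fun v : ℝ => ((v, t) : ℝ × ℝ)) (1, 0) univ u :=
    ((hasDerivAt_id u).prodMk (hasDerivAt_const u t)).hasDerivWithinAt
  have h2 : DifferentiableWithinAt ℝ (fun p : ℝ × ℝ => F p.1 p.2) (univ ×ˢ Iic (0:ℝ)) (u, t) :=
    (h.differentiableOn (by simp)) (u, t) ⟨mem_univ _, ht⟩
  have h3 := h2.hasFDerivWithinAt.comp_hasDerivWithinAt (f := fun v : ℝ => ((v, t) : ℝ × ℝ))
    (t := univ ×ˢ Iic (0:ℝ)) u h1 (fun v _ => ⟨mem_univ _, ht⟩)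
  exact hasDerivWithinAt_univ.1 h3

theorem Sb.hu {F : ℝ → ℝ → E} (h : Sb F) (u : ℝ) {t : ℝ} (ht : t ≤ 0) :
    HasDerivAt (fun v => F v t) (du F u t) u :=
  (h.hu' u ht).differentiableAt.hasDerivAt

theorem Sb.du {F : ℝ → ℝ → E} (h : Sb F) : Sb (du F) := by
  have h1 : ContDiffOn ℝ (⊤ : ℕ∞)
      (fderivWithin ℝ (fun p : ℝ × ℝ => F p.1 p.2) (univ ×ˢ Iic (0:ℝ))) (univ ×ˢ Iic (0:ℝ)) :=
    h.fderivWithin uniq_half (by simp)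
  refine (h1.clm_apply (contDiffOn_const (c := ((1, 0) : ℝ × ℝ)))).congr ?_
  rintro ⟨u, t⟩ ⟨_, ht⟩
  exact (h.hu' u ht).deriv

theorem Sb.cont_u {F : ℝ → ℝ → E} (h : Sb F) {t : ℝ} (ht : t ≤ 0) :
    Continuous (fun u => F u t) :=
  continuous_iff_continuousAt.2 fun u => (h.hu u ht).continuousAt

theorem Sb.cont_t {F : ℝ → ℝ → E} (h : Sb F) (u : ℝ) :
    ContinuousOn (fun t => F u t) (Iic 0) := by
  have : ContinuousOn (fun t : ℝ => ((u, t) : ℝ × ℝ)) (Iic 0) := by fun_prop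
  exact h.continuousOn.comp this (fun t ht => ⟨mem_univ _, ht⟩)

end bdry

/-- speed -/
def spd (γ : ℝ → ℝ → R2) (u t : ℝ) : ℝ := ‖deriv (fun v => γ v t) u‖

section csf

theorem coord_deriv {f : ℝ → R2} {f' : R2} {u : ℝ} (h : HasDerivAt f f' u) (i : Fin 2) :
    HasDerivAt (fun u => f u i) (f' i) u :=
  (EuclideanSpace.proj (𝕜 := ℝ) i : R2 →L[ℝ] ℝ).hasFDerivAt.comp_hasDerivAt u h

variable {γ : ℝ → ℝ → R2} (hc : IsCSF γ (Iic 0))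
include hc

theorem csf_sb : Sb γ := hc.smooth

theorem csf_vpos (u : ℝ) {t : ℝ} (ht : t ≤ 0) : 0 < spd γ u t :=
  norm_pos_iff.2 (hc.regular u t ht)

theorem csf_v : Sb (spd γ) :=
  ContDiffOn.norm ℝ (csf_sb hc).du (fun p hp => hc.regular p.1 p.2 hp.2)

theorem csf_T : Sb (unitT γ) := by
  have h1 : ContDiffOn ℝ (⊤ : ℕ∞) (fun p : ℝ × ℝ => (spd γ p.1 p.2)⁻¹) (univ ×ˢ Iic (0:ℝ)) :=
    ContDiffOn.inv (csf_v hc) (fun p hp => (csf_vpos hc p.1 hp.2).ne')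
  exact h1.smul (csf_sb hc).du

omit hc in
theorem coord_sb {F : ℝ → ℝ → R2} (h : Sb F) (i : Fin 2) : Sb (fun u t => F u t i) :=
  (contDiffOn_piLp 2).1 h i

omit hc in
theorem coord_du {F : ℝ → ℝ → R2} (h : Sb F) (i : Fin 2) (u : ℝ) {t : ℝ} (ht : t ≤ 0) :
    du (fun u t => F u t i) u t = (du F u t) i := 
  (coord_deriv (h.hu u ht) i).deriv

omit hc in
theorem inner2 (a b : R2) : ⟪a, b⟫ = a 0 * b 0 + a 1 * b 1 := by
  simp [PiLp.inner_apply, Fin.sum_univ_two, mul_comm]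

omit hc in
theorem norm2 (a : R2) : ‖a‖ ^ 2 = a 0 ^ 2 + a 1 ^ 2 := by
  simp [EuclideanSpace.norm_sq_eq, Fin.sum_univ_two]

omit hc in
theorem curv_eq (u t : ℝ) : curv γ u t = (spd γ u t)⁻¹ *
    (-(du (unitT γ) u t 0 * unitT γ u t 1) + du (unitT γ) u t 1 * unitT γ u t 0) := by
  rw [curv, inner2]
  simp [aderiv, unitN, Jrot, toR2, spd, du]
  ring

theorem csf_k : Sb (curv γ) := by
  have h1 : ContDiffOn ℝ (⊤ : ℕ∞) (fun p : ℝ × ℝ => (spd γ p.1 p.2)⁻¹) (univ ×ˢ Iic (0:ℝ)) :=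
    ContDiffOn.inv (csf_v hc) (fun p hp => (csf_vpos hc p.1 hp.2).ne')
  have hT := csf_T hc
  have h2 := h1.mul (((ContDiffOn.mul (coord_sb hT.du 0) (coord_sb hT 1)).neg).add
    (ContDiffOn.mul (coord_sb hT.du 1) (coord_sb hT 0)))
  exact h2.congr fun p hp => curv_eq _ _

theorem T_unit (u : ℝ) {t : ℝ} (ht : t ≤ 0) : ‖unitT γ u t‖ = 1 := by
  have := csf_vpos hc u ht
  rw [unitT, aderiv, norm_smul, norm_inv, norm_norm]
  exact inv_mul_cancel₀ this.ne'

theorem T_mul (u : ℝ) {t : ℝ} (ht : t ≤ 0) : du γ u t = spd γ u t • unitT γ u t := by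
  have := csf_vpos hc u ht
  rw [unitT, aderiv, smul_smul]
  change _ = (spd γ u t * (spd γ u t)⁻¹) • _
  rw [mul_inv_cancel₀ this.ne', one_smul]; rfl

theorem T_u (u : ℝ) {t : ℝ} (ht : t ≤ 0) :
    du (unitT γ) u t 0 = -(spd γ u t * curv γ u t * unitT γ u t 1) ∧
    du (unitT γ) u t 1 = spd γ u t * curv γ u t * unitT γ u t 0 := by
  have hv := csf_vpos hc u ht
  have hT := csf_T hc
  have hun : ∀ u, unitT γ u t 0 ^ 2 + unitT γ u t 1 ^ 2 = 1 := fun u => by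
    rw [← norm2, T_unit hc u ht]; norm_num
  have d0 := coord_deriv (hT.hu u ht) 0
  have d1 := coord_deriv (hT.hu u ht) 1
  have h0 : 2 * unitT γ u t 0 * du (unitT γ) u t 0 + 2 * unitT γ u t 1 * du (unitT γ) u t 1 = 0 := by
    have e := (d0.fun_pow 2).fun_add (d1.fun_pow 2)
    simp only [hun] at e
    have := e.unique (hasDerivAt_const u (1:ℝ))
    simpa using this
  have hk : spd γ u t * curv γ u t = 
    (-(du (unitT γ) u t 0 * unitT γ u t 1) + du (unitT γ) u t 1 * unitT γ u t 0) := by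
    rw [curv_eq, ← mul_assoc, mul_inv_cancel₀ hv.ne', one_mul]
  rw [hk]
  have h1 := hun u
  constructor
  · linear_combination (-(du (unitT γ) u t 0)) * h1 + unitT γ u t 0 / 2 * h0
  · linear_combination (-(du (unitT γ) u t 1)) * h1 + unitT γ u t 1 / 2 * h0

theorem flow_t (u : ℝ) {t : ℝ} (ht : t < 0) :
    dt γ u t = (spd γ u t)⁻¹ • du (unitT γ) u t := by
  have := hc.flow u t ht.le
  rw [derivWithin_of_mem_nhds (Iic_mem_nhds ht)] at this
  exact this

theorem csf_fl : Fl (fun u t => γ u t 0) (fun u t => γ u t 1) (spd γ) (curv γ)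
    (fun u t => unitT γ u t 0) (fun u t => unitT γ u t 1) := by
  have hg := csf_sb hc
  have hT := csf_T hc
  have ht' : ∀ i u t, t < 0 → dt (fun u t => γ u t i) u t = (spd γ u t)⁻¹ * du (unitT γ) u t i := by
    intro i u t ht
    have := (coord_deriv (hg.sm.ht u ht) i).deriv
    rw [flow_t hc u ht] at this
    unfold dt
    simpa using this
  refine ⟨(coord_sb hg 0).sm, (coord_sb hg 1).sm, (csf_v hc).sm, (csf_k hc).sm, (coord_sb hT 0).sm,
    (coord_sb hT 1).sm, fun u t ht => csf_vpos hc u ht.le, ?_, ?_, ?_, ?_, ?_, ?_, ?_⟩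
  · intro u t ht
    rw [← norm2, T_unit hc u ht.le]; norm_num
  · intro u t ht
    rw [coord_du hg 0 u ht.le, T_mul hc u ht.le]; simp
  · intro u t ht
    rw [coord_du hg 1 u ht.le, T_mul hc u ht.le]; simp
  · intro u t ht
    have := (csf_vpos hc u ht.le).ne'
    rw [ht' 0 u t ht, (T_u hc u ht.le).1]; field_simp
  · intro u t ht
    have := (csf_vpos hc u ht.le).ne'
    rw [ht' 1 u t ht, (T_u hc u ht.le).2]; field_simp
  · intro u t ht
    rw [coord_du hT 0 u ht.le, (T_u hc u ht.le).1]
  · intro u t ht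
    rw [coord_du hT 1 u ht.le, (T_u hc u ht.le).2]

end csf

section toTC
variable {γ : ℝ → ℝ → R2} (hc : IsCSF γ (Iic 0))
include hc

omit hc in
theorem gw_eq (l u t : ℝ) : gw (fun u t => γ u t 0) (fun u t => γ u t 1) l u t =
    Real.exp (-‖γ u t - 0‖ ^ 2 / (4 * l)) := by
  rw [gw, sub_zero, norm2]

theorem lint_bound (hE : entropyE γ (Iic 0) < ⊤) {t l : ℝ} (ht : t ≤ 0) (hl : 0 < l) :
    ∫⁻ u, ENNReal.ofReal (gw (fun u t => γ u t 0) (fun u t => γ u t 1) l u t * spd γ u t) ≤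
      ENNReal.ofReal ((entropyE γ (Iic 0)).toReal * Real.sqrt (4 * π * l)) := by
  have h1 : gaussLenE γ 0 l t ≤ entropyE γ (Iic 0) := by
    unfold entropyE
    refine le_trans ?_ (le_iSup₂ (f := fun t (_ : t ∈ Iic (0:ℝ)) => ⨆ x₀ : R2, ⨆ l ∈ Ioi (0:ℝ), gaussLenE γ x₀ l t) t ht)
    refine le_trans ?_ (le_iSup (fun x₀ : R2 => ⨆ l ∈ Ioi (0:ℝ), gaussLenE γ x₀ l t) 0)
    exact le_iSup₂ (f := fun l (_ : l ∈ Ioi (0:ℝ)) => gaussLenE γ 0 l t) l hl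
  have hs : 0 < Real.sqrt (4 * π * l) := Real.sqrt_pos.2 (by positivity)
  rw [ENNReal.ofReal_mul ENNReal.toReal_nonneg, ENNReal.ofReal_toReal hE.ne]
  simp only [gw_eq]
  rw [gaussLenE, mul_comm, ← div_eq_mul_inv,
    ENNReal.div_le_iff (by simpa using hs) ENNReal.ofReal_ne_top] at h1
  exact h1

theorem lint_int (hE : entropyE γ (Iic 0) < ⊤) {t l : ℝ} (ht : t < 0) (hl : 0 < l) :
    Integrable (fun u => gw (fun u t => γ u t 0) (fun u t => γ u t 1) l u t * spd γ u t) := by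
  have F := csf_fl hc
  have hcont : Continuous (fun u => gw (fun u t => γ u t 0) (fun u t => γ u t 1) l u t * spd γ u t) :=
    ((F.sgw l).mul F.sv).cont_u ht
  refine ⟨hcont.aestronglyMeasurable, ?_⟩
  have hnn : ∀ u, 0 ≤ gw (fun u t => γ u t 0) (fun u t => γ u t 1) l u t * spd γ u t := fun u =>
    mul_nonneg (Real.exp_pos _).le (F.vpos u t ht).le
  rw [hasFiniteIntegral_iff_ofReal (Eventually.of_forall hnn)]
  exact lt_of_le_of_lt (lint_bound hc hE ht.le hl) ENNReal.ofReal_lt_top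

theorem int_bound (hE : entropyE γ (Iic 0) < ⊤) {t l : ℝ} (ht : t < 0) (hl : 0 < l) {α β : ℝ}
    (hab : α ≤ β) :
    ∫ u in α..β, gw (fun u t => γ u t 0) (fun u t => γ u t 1) l u t * spd γ u t ≤
     (entropyE γ (Iic 0)).toReal * Real.sqrt (4 * π * l) := by
  have F := csf_fl hc
  have hi := lint_int hc hE ht hl
  have hnn : ∀ u, 0 ≤ gw (fun u t => γ u t 0) (fun u t => γ u t 1) l u t * spd γ u t := fun u =>
    mul_nonneg (Real.exp_pos _).le (F.vpos u t ht).le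
  rw [intervalIntegral.integral_of_le hab]
  refine le_trans (setIntegral_le_integral hi (Eventually.of_forall hnn)) ?_
  rw [integral_eq_lintegral_of_nonneg_ae (Eventually.of_forall hnn) hi.aestronglyMeasurable]
  refine ENNReal.toReal_le_of_le_ofReal (by positivity) (lint_bound hc hE ht.le hl)

omit hc in
theorem proper_top (hp : ∀ t ∈ Iic (0:ℝ), IsProperMap fun u => γ u t) {t : ℝ} (ht : t ≤ 0) :
    Tendsto (fun u => γ u t 0 ^ 2 + γ u t 1 ^ 2) (cocompact ℝ) atTop := by
  have h1 : Tendsto (fun u => γ u t) (cocompact ℝ) (cocompact R2) :=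
    (isProperMap_iff_tendsto_cocompact.1 (hp t ht)).2
  have h2 := (tendsto_pow_atTop (n := 2) (by norm_num)).comp
    ((tendsto_norm_cocompact_atTop (E := R2)).comp h1)
  refine h2.congr fun u => ?_
  simp [norm2]

theorem cut_bound (hp : ∀ t ∈ Iic (0:ℝ), IsProperMap fun u => γ u t)
    (hE : entropyE γ (Iic 0) < ⊤) {h h1 h2 : ℝ → ℝ} {M : ℝ} (C : Cut h h1 h2 M) :
    ∃ B : ℝ, ∀ t < 0, ∀ R > 0,
      ∫⁻ u, ENNReal.ofReal (cf h (fun u t => γ u t 0) (fun u t => γ u t 1) R u t *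
        (|curv γ u t| * spd γ u t)) ≤ ENNReal.ofReal B := by
  have F := csf_fl hc
  set E := (entropyE γ (Iic 0)).toReal with hEdef
  refine ⟨12 * (4 + 40 * M) * E * (1 + 120 * E) + 18 * (4 + 40 * M) * E, fun t ht R hR => ?_⟩
  have est := F.est hR C (E := E) ENNReal.toReal_nonneg
    (fun t ht l hl α β hab => int_bound hc hE ht hl hab)
    (fun t ht => lint_int hc hE ht (by positivity))
    (fun t ht => (proper_top hp ht.le).mono_left atTop_le_cocompact)
    (fun t ht => (proper_top hp ht.le).mono_left atBot_le_cocompact) ht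
  have hcf : Continuous (fun u => cf h (fun u t => γ u t 0) (fun u t => γ u t 1) R u t *
      (spd γ u t * Gf (curv γ) R u t)) :=
    ((F.scf hR C.sm).mul (F.sv.mul (F.sG hR))).cont_u ht
  have hnn : ∀ u, 0 ≤ cf h (fun u t => γ u t 0) (fun u t => γ u t 1) R u t *
      (spd γ u t * Gf (curv γ) R u t) := fun u =>
    mul_nonneg (C.nn _) (mul_nonneg (F.vpos u t ht).le (Gf_pos hR _ _).le)
  have hle : ∫⁻ u, ENNReal.ofReal (cf h (fun u t => γ u t 0) (fun u t => γ u t 1) R u t *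
        (|curv γ u t| * spd γ u t)) ≤
      ∫⁻ u, ENNReal.ofReal (cf h (fun u t => γ u t 0) (fun u t => γ u t 1) R u t *
      (spd γ u t * Gf (curv γ) R u t)) := by
    refine lintegral_mono fun u => ENNReal.ofReal_le_ofReal ?_
    refine mul_le_mul_of_nonneg_left ?_ (C.nn _)
    rw [mul_comm]
    exact mul_le_mul_of_nonneg_left (le_Gf _ _) (F.vpos u t ht).le
  refine hle.trans ?_
  have cov : AECover (volume : Measure ℝ) atTop (fun U : ℝ => Ioc (-U) U) :=
    aecover_Ioc tendsto_neg_atTop_atBot tendsto_id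
  refine le_of_tendsto (cov.lintegral_tendsto_of_countably_generated
    (hcf.measurable.ennreal_ofReal.aemeasurable)) ?_
  filter_upwards [est, eventually_ge_atTop 0] with U hU hU0
  rw [← ofReal_integral_eq_lintegral_ofReal (hcf.integrableOn_Ioc)
    (Eventually.of_forall hnn), ← intervalIntegral.integral_of_le (by linarith)]
  exact ENNReal.ofReal_le_ofReal hU

theorem tc_finite (hp : ∀ t ∈ Iic (0:ℝ), IsProperMap fun u => γ u t)
    (hE : entropyE γ (Iic 0) < ⊤) : (⨆ t ∈ Iic (0:ℝ), totalCurvE γ t) < ⊤ := by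
  obtain ⟨h, h1, h2, M, C⟩ := exists_cut
  obtain ⟨B, hB⟩ := cut_bound hc hp hE C
  refine lt_of_le_of_lt (iSup₂_le fun t ht => ?_) (ENNReal.ofReal_lt_top (r := B))
  have ht : t ≤ 0 := ht
  set tn : ℕ → ℝ := fun n => t - 1 / ((n : ℝ) + 1) with htn
  have htn0 : ∀ n, tn n < 0 := fun n => by
    have : 0 < 1 / ((n : ℝ) + 1) := by positivity
    simp only [htn]; linarith
  have htl : Tendsto tn atTop (𝓝[Iic 0] t) := by
    refine tendsto_nhdsWithin_iff.2 ⟨?_, Eventually.of_forall fun n => (htn0 n).le⟩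
    simpa [htn] using (tendsto_const_nhds (x := t)).sub (tendsto_one_div_add_atTop_nhds_zero_nat (𝕜 := ℝ))
  set f : ℕ → ℝ → ℝ≥0∞ := fun n u => ENNReal.ofReal
    (cf h (fun u t => γ u t 0) (fun u t => γ u t 1) ((n : ℝ) + 1) u (tn n) *
        (|curv γ u (tn n)| * spd γ u (tn n))) with hf
  have F := csf_fl hc
  have hfm : ∀ n, Measurable (f n) := fun n => by
    have hR : (0:ℝ) < (n : ℝ) + 1 := by positivity
    have a1 := (F.scf hR C.sm).cont_u (htn0 n)
    have a2 := F.sk.cont_u (htn0 n)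
    have a3 := F.sv.cont_u (htn0 n)
    exact (a1.mul (a2.abs.mul a3)).measurable.ennreal_ofReal
  have hlim : ∀ u, Tendsto (fun n => f n u) atTop (𝓝 (ENNReal.ofReal (|curv γ u t| * spd γ u t))) := by
    intro u
    have key : ∀ {G : ℝ → ℝ → ℝ}, Sb G → Tendsto (fun n => G u (tn n)) atTop (𝓝 (G u t)) := by
      intro G hG
      exact (hG.cont_t u t ht).tendsto.comp htl
    have kk := key (csf_k hc)
    have kv := key (csf_v hc)
    have kx := key (coord_sb (csf_sb hc) 0)
    have ky := key (coord_sb (csf_sb hc) 1)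
    have hRt : Tendsto (fun n : ℕ => (1 / ((n : ℝ) + 1)) ^ 2) atTop (𝓝 (0 ^ 2)) :=
      (tendsto_one_div_add_atTop_nhds_zero_nat (𝕜 := ℝ)).pow 2
    have hD := ((kx.pow 2).add (ky.pow 2)).mul hRt
    rw [zero_pow two_ne_zero, mul_zero] at hD
    have hev : ∀ᶠ n : ℕ in atTop,
        cf h (fun u t => γ u t 0) (fun u t => γ u t 1) ((n : ℝ) + 1) u (tn n) = 1 := by
      filter_upwards [hD.eventually_lt_const (show (0:ℝ) < 1 by norm_num)] with n hn
      refine C.one _ ?_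
      rw [one_div, inv_pow, ← div_eq_mul_inv] at hn
      exact hn.le
    refine (ENNReal.continuous_ofReal.tendsto _).comp ((kk.abs.mul kv).congr' ?_)
    filter_upwards [hev] with n hn
    rw [hn, one_mul]
  calc totalCurvE γ t = ∫⁻ u, liminf (fun n => f n u) atTop :=
        lintegral_congr fun u => (hlim u).liminf_eq.symm
    _ ≤ liminf (fun n => ∫⁻ u, f n u) atTop := lintegral_liminf_le hfm
    _ ≤ ENNReal.ofReal B := by
        refine liminf_le_of_le (by isBoundedDefault) fun b hb => ?_
        obtain ⟨n, hn⟩ := hb.exists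
        exact hn.trans (hB _ (htn0 n) _ (by positivity))

end toTC

section toEnt

theorem piece {g T T' : ℝ → R2} {v w : ℝ → ℝ} (hg : ∀ u, HasDerivAt g (v u • T u) u)
    (hT : ∀ u, HasDerivAt T (T' u) u) (hT' : ∀ u, ‖T' u‖ ≤ w u) (hv : ∀ u, 0 < v u)
    (hwc : Continuous w) (hTc : Continuous T')
    (hT1 : ∀ u, ‖T u‖ = 1) {J : Set ℝ} (hJ : J.OrdConnected)
    (hJw : ∀ a ∈ J, ∀ b ∈ J, a ≤ b → ∫ u in a..b, w u ≤ 1 / 2) (x₀ : R2) {l : ℝ} (hl : 0 < l) :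
    ∫⁻ u in J, ENNReal.ofReal (Real.exp (-‖g u - x₀‖ ^ 2 / (4 * l)) * v u) ≤
      ENNReal.ofReal (2 * Real.sqrt (4 * π * l)) := by
  rcases J.eq_empty_or_nonempty with rfl | ⟨a, ha⟩
  · simp
  have hab : ∀ a b, a ≤ b → ‖T b - T a‖ ≤ ∫ u in a..b, w u := by
    intro a b hab
    rw [← intervalIntegral.integral_eq_sub_of_hasDerivAt (fun u _ => hT u)
      (hTc.intervalIntegrable _ _)]
    exact intervalIntegral.norm_integral_le_of_norm_le hab (Eventually.of_forall fun u _ => hT' u)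
      (hwc.intervalIntegrable _ _)
  have hclose : ∀ u ∈ J, ‖T u - T a‖ ≤ 1 / 2 := by
    intro u hu
    rcases le_total a u with h | h
    · exact (hab a u h).trans (hJw a ha u hu h)
    · rw [norm_sub_rev]; exact (hab u a h).trans (hJw u hu a ha h)
  have hin : ∀ u ∈ J, 1 / 2 ≤ ⟪T u, T a⟫ := by
    intro u hu
    have h1 := norm_sub_sq_real (T u) (T a)
    rw [hT1, hT1] at h1
    have h2 := hclose u hu
    nlinarith [norm_nonneg (T u - T a)]
  set f : ℝ → ℝ := fun u => ⟪g u - x₀, T a⟫ with hf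
  have hfd : ∀ u, HasDerivAt f (v u * ⟪T u, T a⟫) u := by
    intro u
    have := ((hg u).sub_const x₀).inner ℝ (hasDerivAt_const u (T a))
    simpa [real_inner_smul_left] using this
  have hpos : ∀ u ∈ J, 0 < v u * ⟪T u, T a⟫ := fun u hu =>
    mul_pos (hv u) (by linarith [hin u hu])
  have hmono : StrictMonoOn f J := by
    refine strictMonoOn_of_deriv_pos hJ.convex
      (fun u _ => (hfd u).continuousAt.continuousWithinAt) fun u hu => ?_
    rw [(hfd u).deriv]
    exact hpos u (interior_subset hu)
  have hJm : MeasurableSet J := hJ.measurableSet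
  have cov := lintegral_image_eq_lintegral_abs_deriv_mul hJm
    (fun u _ => (hfd u).hasDerivWithinAt) hmono.injOn
    (fun y => ENNReal.ofReal (2 * Real.exp (-(1 / (4 * l)) * y ^ 2)))
  calc _ ≤ ∫⁻ u in J, ENNReal.ofReal |v u * ⟪T u, T a⟫| *
          ENNReal.ofReal (2 * Real.exp (-(1 / (4 * l)) * f u ^ 2)) := by
        refine setLIntegral_mono' hJm fun u hu => ?_
        rw [← ENNReal.ofReal_mul (abs_nonneg _)]
        refine ENNReal.ofReal_le_ofReal ?_
        rw [abs_of_pos (hpos u hu)]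
        have h1 : |f u| ≤ ‖g u - x₀‖ := by
          have := abs_real_inner_le_norm (g u - x₀) (T a)
          rwa [hT1, mul_one] at this
        have h2 : f u ^ 2 ≤ ‖g u - x₀‖ ^ 2 := by
          rw [← sq_abs (f u)]; gcongr
        have h3 : Real.exp (-‖g u - x₀‖ ^ 2 / (4 * l)) ≤ Real.exp (-(1 / (4 * l)) * f u ^ 2) := by
          apply Real.exp_le_exp.2
          have : f u ^ 2 / (4 * l) ≤ ‖g u - x₀‖ ^ 2 / (4 * l) := by gcongr
          have e : -(1 / (4 * l)) * f u ^ 2 = -(f u ^ 2 / (4 * l)) := by ring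
          rw [e, neg_div]; linarith
        have hi := hin u hu
        have hvu := hv u
        calc _ ≤ Real.exp (-(1 / (4 * l)) * f u ^ 2) * v u := by gcongr
          _ ≤ Real.exp (-(1 / (4 * l)) * f u ^ 2) * (v u * (2 * ⟪T u, T a⟫)) := by
              gcongr
              nlinarith
          _ = _ := by ring
    _ = ∫⁻ y in f '' J, ENNReal.ofReal (2 * Real.exp (-(1 / (4 * l)) * y ^ 2)) := cov.symm
    _ ≤ ∫⁻ y, ENNReal.ofReal (2 * Real.exp (-(1 / (4 * l)) * y ^ 2)) := setLIntegral_le_lintegral _ _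
    _ = ENNReal.ofReal (2 * Real.sqrt (4 * π * l)) := by
        rw [← ofReal_integral_eq_lintegral_ofReal
          ((integrable_exp_neg_mul_sq (by positivity)).const_mul 2)
          (Eventually.of_forall fun y => by positivity), integral_const_mul, integral_gaussian]
        congr 3
        field_simp

theorem static {g T T' : ℝ → R2} {v w : ℝ → ℝ} (hg : ∀ u, HasDerivAt g (v u • T u) u)
    (hT : ∀ u, HasDerivAt T (T' u) u) (hT' : ∀ u, ‖T' u‖ ≤ w u) (hv : ∀ u, 0 < v u)
    (hwc : Continuous w) (hTc : Continuous T')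
    (hT1 : ∀ u, ‖T u‖ = 1) {K : ℝ} (hK : ∫⁻ u, ENNReal.ofReal (w u) ≤ ENNReal.ofReal K)
    (hK0 : 0 ≤ K) (x₀ : R2) {l : ℝ} (hl : 0 < l) :
    ∫⁻ u, ENNReal.ofReal (Real.exp (-‖g u - x₀‖ ^ 2 / (4 * l)) * v u) ≤
      ((⌊2 * K⌋₊ + 1 : ℕ) : ℝ≥0∞) * ENNReal.ofReal (2 * Real.sqrt (4 * π * l)) := by
  have hw0 : ∀ u, 0 ≤ w u := fun u => (norm_nonneg _).trans (hT' u)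
  have hwi : Integrable w := by
    refine ⟨hwc.aestronglyMeasurable, ?_⟩
    rw [hasFiniteIntegral_iff_ofReal (Eventually.of_forall hw0)]
    exact lt_of_le_of_lt hK ENNReal.ofReal_lt_top
  have hwK : ∫ u, w u ≤ K := by
    rw [integral_eq_lintegral_of_nonneg_ae (Eventually.of_forall hw0) hwi.aestronglyMeasurable]
    exact ENNReal.toReal_le_of_le_ofReal hK0 hK
  set τ : ℝ → ℝ := fun u => ∫ r in Iic u, w r with hτ
  have hτ0 : ∀ u, 0 ≤ τ u := fun u => integral_nonneg hw0
  have hτK : ∀ u, τ u ≤ K := fun u =>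
    (setIntegral_le_integral hwi (Eventually.of_forall hw0)).trans hwK
  have hτd : ∀ a b, ∫ u in a..b, w u = τ b - τ a := fun a b =>
    (intervalIntegral.integral_Iic_sub_Iic hwi.integrableOn hwi.integrableOn).symm
  have hτm : Monotone τ := by
    intro a b hab
    have := intervalIntegral.integral_nonneg (μ := volume) hab (fun u _ => hw0 u)
    rw [hτd] at this; linarith
  set J : Fin (⌊2 * K⌋₊ + 1) → Set ℝ := fun j => τ ⁻¹' Ico ((j : ℝ) / 2) (((j : ℝ) + 1) / 2) with hJ
  have hun : (⋃ j, J j) = univ := by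
    refine eq_univ_of_forall fun u => mem_iUnion.2 ?_
    have h0 : 0 ≤ 2 * τ u := by linarith [hτ0 u]
    refine ⟨⟨⌊2 * τ u⌋₊, Nat.lt_succ_of_le (Nat.floor_le_floor (by linarith [hτK u]))⟩, ?_⟩
    simp only [hJ, mem_preimage, mem_Ico]
    have h1 := Nat.floor_le h0
    have h2 := Nat.lt_floor_add_one (2 * τ u)
    constructor <;> linarith
  rw [← setLIntegral_univ, ← hun]
  refine (lintegral_iUnion_le _ _).trans ?_
  rw [tsum_fintype]
  refine (Finset.sum_le_card_nsmul _ _ (ENNReal.ofReal (2 * Real.sqrt (4 * π * l))) fun j _ => ?_).trans ?_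
  · refine piece hg hT hT' hv hwc hTc hT1 (ordConnected_Ico.preimage_mono hτm) ?_ x₀ hl
    intro a ha b hb hab
    rw [hτd]
    have h1 := ha.1
    have h2 := hb.2
    linarith
  · simp

theorem ent_finite {γ : ℝ → ℝ → R2} (hc : IsCSF γ (Iic 0))
    (hK : (⨆ t ∈ Iic (0:ℝ), totalCurvE γ t) < ⊤) : entropyE γ (Iic 0) < ⊤ := by
  set K := (⨆ t ∈ Iic (0:ℝ), totalCurvE γ t).toReal with hKdef
  have hKe : ∀ t ≤ 0, totalCurvE γ t ≤ ENNReal.ofReal K := by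
    intro t ht
    rw [hKdef, ENNReal.ofReal_toReal hK.ne]
    exact le_iSup₂ (f := fun t (_ : t ∈ Iic (0:ℝ)) => totalCurvE γ t) t ht
  refine lt_of_le_of_lt (b := ((⌊2 * K⌋₊ + 1 : ℕ) : ℝ≥0∞) * ENNReal.ofReal 2) ?_
    (ENNReal.mul_lt_top (ENNReal.natCast_lt_top _) ENNReal.ofReal_lt_top)
  refine iSup₂_le fun t ht => iSup_le fun x₀ => iSup₂_le fun l hl => ?_
  have ht : t ≤ 0 := ht
  have hl : 0 < l := hl
  have hs : 0 < Real.sqrt (4 * π * l) := Real.sqrt_pos.2 (by positivity)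
  have hTb := csf_T hc
  have st := static (g := fun u => γ u t) (T := fun u => unitT γ u t)
    (T' := fun u => du (unitT γ) u t) (v := fun u => spd γ u t)
    (w := fun u => |curv γ u t| * spd γ u t)
    (fun u => by rw [← T_mul hc u ht]; exact (csf_sb hc).hu u ht)
    (fun u => hTb.hu u ht)
    (fun u => by
      have hv := csf_vpos hc u ht
      obtain ⟨h0, h1⟩ := T_u hc u ht
      refine abs_le_of_sq_le_sq' ?_ (by positivity) |>.2
      rw [norm2, h0, h1]
      have hu : unitT γ u t 0 ^ 2 + unitT γ u t 1 ^ 2 = 1 := by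
        rw [← norm2, T_unit hc u ht]; norm_num
      rw [mul_pow |curv γ u t|, sq_abs]
      apply le_of_eq
      linear_combination (spd γ u t ^ 2 * curv γ u t ^ 2) * hu)
    (fun u => csf_vpos hc u ht)
    (((csf_k hc).cont_u ht).abs.mul ((csf_v hc).cont_u ht))
    (hTb.du.cont_u ht) (fun u => T_unit hc u ht) (hKe t ht) ENNReal.toReal_nonneg x₀ hl
  rw [gaussLenE, mul_comm, ← div_eq_mul_inv,
    ENNReal.div_le_iff (by simpa using hs) ENNReal.ofReal_ne_top, mul_assoc,
    ← ENNReal.ofReal_mul (by norm_num)]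
  exact st

end toEnt
/-- An ancient complete non-compact embedded smooth curve shortening flow
has finite total curvature if and only if it has finite entropy. -/
theorem finite_total_curvature_iff_finite_entropy
    (γ : ℝ → ℝ → R2)
    (hcsf : IsCSF γ (Iic 0))
    (hemb : ∀ t ∈ Iic (0:ℝ), Function.Injective fun u => γ u t)
    (hproper : ∀ t ∈ Iic (0:ℝ), IsProperMap fun u => γ u t) :
    (⨆ t ∈ Iic (0:ℝ), totalCurvE γ t) < ⊤ ↔ entropyE γ (Iic 0) < ⊤ := by
  exact ⟨ent_finite hcsf, tc_finite hcsf hproper⟩
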